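/- arXiv:1805.02554 — 6 statements merged into one kernel-verified Lean document; each statement's English description precedes it below -/
import Mathlib

section
/- Let n be a positive natural number and let F be a lattice freely generated by a family x : Fin n → F. Then there exists a group isomorphism Φ from the symmetric group Equiv.Perm (Fin n) onto the group of automorphisms of F (order isomorphisms F ≃o F under composition) such that Φ σ (x i) = x (σ i) for every permutation σ of Fin n and every i. In particular, every automorphism of F is induced by a unique permutation of the free generators. -/
open Cardinal

universe u

/-- A lattice `F` is freely generated by the family `x : ι → F` if the sublattice generated by
the range of `x` is all of `F` and every map from the generators into a lattice extends to a
lattice homomorphism. -/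
def IsFreelyGenerated {F : Type*} [Lattice F] {ι : Type*} (x : ι → F) : Prop :=
  latticeClosure (Set.range x) = Set.univ ∧
    ∀ (K : Type*) [Lattice K] (f : ι → K), ∃ φ : LatticeHom F K, ∀ i, φ (x i) = f i

theorem gen_induction {F : Type*} [Lattice F] {ι : Type*} {x : ι → F}
    (h : latticeClosure (Set.range x) = Set.univ) (p : F → Prop)
    (hg : ∀ i, p (x i)) (hs : ∀ a b, p a → p b → p (a ⊔ b))
    (hi : ∀ a b, p a → p b → p (a ⊓ b)) (w : F) : p w := by
  have hsub : IsSublattice {w | p w} :=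
    ⟨fun a ha b hb => hs a b ha hb, fun a ha b hb => hi a b ha hb⟩
  have : latticeClosure (Set.range x) ⊆ {w | p w} :=
    latticeClosure_min (by rintro _ ⟨i, rfl⟩; exact hg i) hsub
  exact this (h ▸ Set.mem_univ w)

/-- Lattice terms. -/
inductive LTerm (n : ℕ) : Type
  | var : Fin n → LTerm n
  | sup : LTerm n → LTerm n → LTerm n
  | inf : LTerm n → LTerm n → LTerm n

/-- Evaluation of lattice terms. -/
def LTerm.eval {n : ℕ} {F : Type*} [Lattice F] (x : Fin n → F) : LTerm n → F
  | .var i => x i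
  | .sup a b => a.eval x ⊔ b.eval x
  | .inf a b => a.eval x ⊓ b.eval x

theorem small_of_gen {n : ℕ} {F : Type*} [Lattice F] {x : Fin n → F}
    (h : latticeClosure (Set.range x) = Set.univ) : Small.{u} F := by
  have hsurj : Function.Surjective (LTerm.eval x) := by
    intro w
    refine gen_induction h (fun w => ∃ t, LTerm.eval x t = w) ?_ ?_ ?_ w
    · exact fun i => ⟨.var i, rfl⟩
    · rintro _ _ ⟨s, rfl⟩ ⟨t, rfl⟩; exact ⟨.sup s t, rfl⟩
    · rintro _ _ ⟨s, rfl⟩ ⟨t, rfl⟩; exact ⟨.inf s t, rfl⟩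
  exact small_of_surjective hsurj

theorem hom_ext_gen {F K : Type*} [Lattice F] [Lattice K] {ι : Type*} {x : ι → F}
    (h : latticeClosure (Set.range x) = Set.univ) {φ ψ : LatticeHom F K}
    (e : ∀ i, φ (x i) = ψ (x i)) (w : F) : φ w = ψ w := by
  refine gen_induction h (fun w => φ w = ψ w) e ?_ ?_ w
  · intro a b ha hb; simp only [map_sup, ha, hb]
  · intro a b ha hb; simp only [map_inf, ha, hb]

/-- Extension of maps into lattices that are small, whatever the universe. -/
theorem extend_small {F : Type*} [Lattice F] {ι : Type*} {x : ι → F}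
    (h : ∀ (K : Type u) [Lattice K] (f : ι → K), ∃ φ : LatticeHom F K, ∀ i, φ (x i) = f i)
    (K : Type*) [Lattice K] [Small.{u} K] (f : ι → K) :
    ∃ φ : LatticeHom F K, ∀ i, φ (x i) = f i := by
  let e : K ≃ Shrink.{u} K := equivShrink K
  let _ : Max (Shrink.{u} K) := ⟨fun a b => e (e.symm a ⊔ e.symm b)⟩
  let _ : Min (Shrink.{u} K) := ⟨fun a b => e (e.symm a ⊓ e.symm b)⟩
  let _ : LE (Shrink.{u} K) := ⟨fun a b => e.symm a ≤ e.symm b⟩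
  let _ : LT (Shrink.{u} K) := ⟨fun a b => e.symm a < e.symm b⟩
  have hs : ∀ a b : Shrink.{u} K, e.symm (a ⊔ b) = e.symm a ⊔ e.symm b :=
    fun a b => e.symm_apply_apply _
  have hi : ∀ a b : Shrink.{u} K, e.symm (a ⊓ b) = e.symm a ⊓ e.symm b :=
    fun a b => e.symm_apply_apply _
  let _ : Lattice (Shrink.{u} K) :=
    Function.Injective.lattice e.symm e.symm.injective Iff.rfl Iff.rfl hs hi
  obtain ⟨φ, hφ⟩ := h (Shrink.{u} K) (fun i => e (f i))
  refine ⟨⟨⟨fun w => e.symm (φ w), fun a b => ?_⟩, fun a b => ?_⟩, fun i => ?_⟩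
  · change e.symm (φ (a ⊔ b)) = _
    rw [map_sup]; exact hs _ _
  · change e.symm (φ (a ⊓ b)) = _
    rw [map_inf]; exact hi _ _
  · change e.symm (φ (x i)) = _
    rw [hφ]; exact e.symm_apply_apply _

/-- Double irreducibility. -/
def DblIrr {F : Type*} [Lattice F] (w : F) : Prop :=
  (∀ a b, w = a ⊔ b → w = a ∨ w = b) ∧ (∀ a b, w = a ⊓ b → w = a ∨ w = b)

theorem DblIrr.map {F : Type*} [Lattice F] {w : F} (h : DblIrr w) (g : F ≃o F) :
    DblIrr (g w) := by
  constructor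
  · intro a b e
    have : w = g.symm a ⊔ g.symm b := by rw [← map_sup, ← e, g.symm_apply_apply]
    rcases h.1 _ _ this with h | h
    · left; rw [h, g.apply_symm_apply]
    · right; rw [h, g.apply_symm_apply]
  · intro a b e
    have : w = g.symm a ⊓ g.symm b := by rw [← map_inf, ← e, g.symm_apply_apply]
    rcases h.2 _ _ this with h | h
    · left; rw [h, g.apply_symm_apply]
    · right; rw [h, g.apply_symm_apply]

theorem DblIrr.mem_range {F : Type*} [Lattice F] {ι : Type*} {x : ι → F}
    (h : latticeClosure (Set.range x) = Set.univ) {w : F} (hw : DblIrr w) : ∃ i, x i = w := by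
  refine gen_induction h (fun w => DblIrr w → ∃ i, x i = w) ?_ ?_ ?_ w hw
  · exact fun i _ => ⟨i, rfl⟩
  · intro a b ha hb hab
    rcases hab.1 a b rfl with h | h
    · rw [h] at hab ⊢; exact ha hab
    · rw [h] at hab ⊢; exact hb hab
  · intro a b ha hb hab
    rcases hab.2 a b rfl with h | h
    · rw [h] at hab ⊢; exact ha hab
    · rw [h] at hab ⊢; exact hb hab

theorem dblIrr_gen {F : Type*} [Lattice F] {ι : Type*} {x : ι → F}
    (hc : latticeClosure (Set.range x) = Set.univ)
    (h : ∀ (f : ι → Prop), ∃ φ : LatticeHom F Prop, ∀ i, φ (x i) = f i) (i : ι) :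
    DblIrr (x i) := by
  constructor
  · obtain ⟨φ, hφ⟩ := h (fun j => j = i)
    have key : ∀ w, φ w → x i ≤ w := by
      refine gen_induction hc _ ?_ ?_ ?_
      · intro j hj; rw [hφ] at hj; rw [hj]
      · intro a b ha hb hab
        rw [map_sup] at hab
        rcases hab with hab | hab
        · exact (ha hab).trans le_sup_left
        · exact (hb hab).trans le_sup_right
      · intro a b ha hb hab
        rw [map_inf] at hab
        exact le_inf (ha hab.1) (hb hab.2)
    intro a b e
    have h1 : φ (a ⊔ b) := by rw [← e, hφ]
    rw [map_sup] at h1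
    rcases h1 with h1 | h1
    · left; exact le_antisymm (key _ h1) (e ▸ le_sup_left)
    · right; exact le_antisymm (key _ h1) (e ▸ le_sup_right)
  · obtain ⟨φ, hφ⟩ := h (fun j => j ≠ i)
    have key : ∀ w, ¬ φ w → w ≤ x i := by
      refine gen_induction hc _ ?_ ?_ ?_
      · intro j hj; rw [hφ, not_not] at hj; rw [hj]
      · intro a b ha hb hab
        rw [map_sup] at hab
        exact sup_le (ha fun h => hab (Or.inl h)) (hb fun h => hab (Or.inr h))
      · intro a b ha hb hab
        rw [map_inf] at hab
        by_cases h1 : φ a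
        · exact inf_le_right.trans (hb fun h2 => hab ⟨h1, h2⟩)
        · exact inf_le_left.trans (ha h1)
    intro a b e
    have h1 : ¬ φ (a ⊓ b) := by rw [← e, hφ]; simp
    rw [map_inf] at h1
    by_cases h2 : φ a
    · right; exact le_antisymm (e ▸ inf_le_right) (key _ fun h3 => h1 ⟨h2, h3⟩)
    · left; exact le_antisymm (e ▸ inf_le_left) (key _ h2)

theorem aut_group_iso_perm {n : ℕ} (hn : 0 < n)
    {F : Type*} [Lattice F] (x : Fin n → F) (hx : IsFreelyGenerated x) :
    ∃ Φ : Equiv.Perm (Fin n) ≃* (F ≃o F),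
      ∀ (σ : Equiv.Perm (Fin n)) (i : Fin n), (Φ σ) (x i) = x (σ i) := by
  obtain ⟨hc, hk⟩ := hx
  have hP : ∀ (f : Fin n → Prop), ∃ φ : LatticeHom F Prop, ∀ i, φ (x i) = f i :=
    fun f => extend_small hk Prop f
  have hinj : Function.Injective x := by
    intro i j hij
    obtain ⟨φ, hφ⟩ := hP (fun k => k = j)
    have := hφ i
    rw [hij, hφ] at this
    simpa using this
  have hirr : ∀ i, DblIrr (x i) := dblIrr_gen hc hP
  have hF : ∀ f : Fin n → F, ∃ φ : LatticeHom F F, ∀ i, φ (x i) = f i := by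
    intro f
    have := small_of_gen hc
    exact extend_small hk F f
  choose E hE using fun σ : Equiv.Perm (Fin n) => hF (fun i => x (σ i))
  have hmul : ∀ σ τ w, E (σ * τ) w = E σ (E τ w) := by
    intro σ τ w
    refine hom_ext_gen (ψ := (E σ).comp (E τ)) hc (fun i => ?_) w
    simp [hE]
  have hone : ∀ w, E 1 w = w := by
    intro w
    refine hom_ext_gen (ψ := LatticeHom.id F) hc (fun i => ?_) w
    simp [hE]
  let A : Equiv.Perm (Fin n) → (F ≃o F) := fun σ =>
    Equiv.toOrderIso ⟨E σ, E σ⁻¹, fun w => by rw [← hmul, inv_mul_cancel, hone],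
      fun w => by rw [← hmul, mul_inv_cancel, hone]⟩
      (OrderHomClass.mono (E σ)) (OrderHomClass.mono (E σ⁻¹))
  have hA : ∀ σ w, A σ w = E σ w := fun _ _ => rfl
  let Ψ : Equiv.Perm (Fin n) →* (F ≃o F) :=
    { toFun := A
      map_one' := by ext w; exact hone w
      map_mul' := fun σ τ => by ext w; exact hmul σ τ w }
  have hΨ : ∀ σ i, Ψ σ (x i) = x (σ i) := fun σ i => hE σ i
  refine ⟨MulEquiv.ofBijective Ψ ⟨?_, ?_⟩, hΨ⟩
  · intro σ τ h
    ext1 i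
    apply hinj
    rw [← hΨ, ← hΨ, h]
  · intro g
    choose s hs using fun i => ((hirr i).map g).mem_range hc
    have hsi : Function.Injective s := by
      intro i j hij
      apply hinj
      apply g.injective
      rw [← hs, ← hs, hij]
    let σ : Equiv.Perm (Fin n) := Equiv.ofBijective s (Finite.injective_iff_bijective.1 hsi)
    refine ⟨σ, ?_⟩
    ext w
    refine hom_ext_gen (φ := E σ) (ψ := (g : LatticeHom F F)) hc (fun i => ?_) w
    rw [hE]
    exact hs i
end

section
/- For every j ∈ ℕ, the elements m j and (m j)̄ are symmetric elements of F, and a, ā, b, b̄ are symmetric elements of F. Moreover, the set {a, ā, b, b̄, x 0} has exactly five elements, and it freely generates: for every lattice K and all elements k₁, k₂, k₃, k₄, k₅ of K, there exists a lattice homomorphism from the sublattice of F generated by {a, ā, b, b̄, x 0} to K sending a to k₁, ā to k₂, b to k₃, b̄ to k₄, and x 0 to k₅. -/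
open Cardinal

universe u

/-- An element `u` of a lattice is symmetric if it is fixed by every automorphism. -/
def IsSymmElem {F : Type*} [Lattice F] (u : F) : Prop := ∀ π : F ≃o F, π u = u

/-- The image of `t` under a dual automorphism `δ : F ≃o Fᵒᵈ`, viewed back in `F`. -/
def dBar {F : Type*} [Lattice F] (δ : F ≃o Fᵒᵈ) (t : F) : F := OrderDual.ofDual (δ t)

/-- A subset `S` of `F` is selfdually positioned (w.r.t. the dual automorphism `δ`)
if `δ '' S = S`. -/
def SelfduallyPositioned {F : Type*} [Lattice F] (δ : F ≃o Fᵒᵈ) (S : Set F) : Prop :=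
  dBar δ '' S = S

/-- The elements `p i j` of `F`: `p i 0 = x i` and `p i (j+1)` is `x i` joined with the
supremum of `p i₁ j ⊓ p i₂ j` over all pairs `i₁ ≠ i₂` avoiding `i`. -/
def freeP {n : ℕ} {F : Type*} [Lattice F] (x : Fin n → F) : ℕ → Fin n → F
  | 0, i => x i
  | j + 1, i =>
    (Finset.univ.filter fun q : Fin n × Fin n => q.1 ≠ q.2 ∧ q.1 ≠ i ∧ q.2 ≠ i).fold
      (· ⊔ ·) (x i) (fun q => freeP x j q.1 ⊓ freeP x j q.2)

/-- The element `m j`: the supremum of `p i₁ j ⊓ p i₂ j` over all pairs `i₁ ≠ i₂`. -/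
def freeM {n : ℕ} {F : Type*} [Lattice F] (hn : 3 ≤ n) (x : Fin n → F) (j : ℕ) : F :=
  (Finset.univ.filter fun q : Fin n × Fin n => q.1 ≠ q.2).sup'
    ⟨(⟨0, by omega⟩, ⟨1, by omega⟩), by simp [Fin.ext_iff]⟩
    (fun q => freeP x j q.1 ⊓ freeP x j q.2)

/-- The element `a := m 1 ⊔ (m 3)̄`. -/
def aElem {n : ℕ} {F : Type*} [Lattice F] (hn : 3 ≤ n) (x : Fin n → F) (δ : F ≃o Fᵒᵈ) : F :=
  freeM hn x 1 ⊔ dBar δ (freeM hn x 3)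

/-- The element `b := m 2 ⊔ (m 4)̄`. -/
def bElem {n : ℕ} {F : Type*} [Lattice F] (hn : 3 ≤ n) (x : Fin n → F) (δ : F ≃o Fᵒᵈ) : F :=
  freeM hn x 2 ⊔ dBar δ (freeM hn x 4)

/-- The sublattice of `F` generated by a subset `S`. -/
def genSub {F : Type*} [Lattice F] (S : Set F) : Sublattice F :=
  Sublattice.ofIsSublattice (latticeClosure S) isSublattice_latticeClosure


namespace KL

/-- Data and facts extracted from the free lattice; the package is self-dual. -/
structure Setup {F : Type*} [Lattice F] {n : ℕ} (x : Fin n → F) (p pb : ℕ → Fin n → F)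
    (m mb : ℕ → F) : Prop where
  hn : 3 ≤ n
  W : ∀ s t u v : F, s ⊓ t ≤ u ⊔ v → s ≤ u ⊔ v ∨ t ≤ u ⊔ v ∨ s ⊓ t ≤ u ∨ s ⊓ t ≤ v
  jp : ∀ i s t, x i ≤ s ⊔ t → x i ≤ s ∨ x i ≤ t
  mp : ∀ i s t, s ⊓ t ≤ x i → s ≤ x i ∨ t ≤ x i
  inj : ∀ i j, x i ≤ x j → i = j
  p0 : ∀ i, p 0 i = x i
  ps : ∀ j i, p (j + 1) i = x i ⊔ m j
  pb0 : ∀ i, pb 0 i = x i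
  pbs : ∀ j i, pb (j + 1) i = x i ⊓ mb j
  mle : ∀ j k l, k ≠ l → p j k ⊓ p j l ≤ m j
  mble : ∀ j k l, k ≠ l → mb j ≤ pb j k ⊔ pb j l
  mlub : ∀ j z, (∀ k l, k ≠ l → p j k ⊓ p j l ≤ z) → m j ≤ z
  mbglb : ∀ j z, (∀ k l, k ≠ l → z ≤ pb j k ⊔ pb j l) → z ≤ mb j
  mW : ∀ j u v, u ⊓ v ≤ m j → u ≤ m j ∨ v ≤ m j ∨ ∃ k l, k ≠ l ∧ u ⊓ v ≤ p j k ⊓ p j l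
  mbW : ∀ j u v, mb j ≤ u ⊔ v → mb j ≤ u ∨ mb j ≤ v ∨ ∃ k l, k ≠ l ∧ pb j k ⊔ pb j l ≤ u ⊔ v
  mJ : ∀ j i, x i ≤ m j → ∃ k l, k ≠ l ∧ x i ≤ p j k ⊓ p j l
  mbJ : ∀ j i, mb j ≤ x i → ∃ k l, k ≠ l ∧ pb j k ⊔ pb j l ≤ x i
  mbm : ∀ c j, mb c ≤ m j → (∃ k l, k ≠ l ∧ pb c k ⊔ pb c l ≤ m j) ∨
    ∃ k l, k ≠ l ∧ mb c ≤ p j k ⊓ p j l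

namespace Setup

variable {F : Type*} [Lattice F] {n : ℕ} {x : Fin n → F} {p pb : ℕ → Fin n → F} {m mb : ℕ → F}

theorem dual (S : Setup x p pb m mb) :
    Setup (F := Fᵒᵈ) (fun i => OrderDual.toDual (x i)) (fun j i => OrderDual.toDual (pb j i))
      (fun j i => OrderDual.toDual (p j i)) (fun j => OrderDual.toDual (mb j))
      (fun j => OrderDual.toDual (m j)) where
  hn := S.hn
  W := fun s t u v h => by
    rcases S.W (OrderDual.ofDual u) (OrderDual.ofDual v) (OrderDual.ofDual s) (OrderDual.ofDual t) h
      with h | h | h | h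
    · exact Or.inr (Or.inr (Or.inl h))
    · exact Or.inr (Or.inr (Or.inr h))
    · exact Or.inl h
    · exact Or.inr (Or.inl h)
  jp := fun i s t h => S.mp i (OrderDual.ofDual s) (OrderDual.ofDual t) h
  mp := fun i s t h => S.jp i (OrderDual.ofDual s) (OrderDual.ofDual t) h
  inj := fun i j h => (S.inj j i h).symm
  p0 := S.pb0
  ps := S.pbs
  pb0 := S.p0
  pbs := S.ps
  mle := S.mble
  mble := S.mle
  mlub := S.mbglb
  mbglb := S.mlub
  mW := fun j u v h => S.mbW j (OrderDual.ofDual u) (OrderDual.ofDual v) h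
  mbW := fun j u v h => S.mW j (OrderDual.ofDual u) (OrderDual.ofDual v) h
  mJ := S.mbJ
  mbJ := S.mJ
  mbm := fun c j h => (S.mbm j c h).symm

theorem pick (S : Setup x p pb m mb) (k : Fin n) : ∃ a b : Fin n, a ≠ b ∧ a ≠ k ∧ b ≠ k := by
  have := S.hn
  by_cases h0 : k.val = 0
  · exact ⟨⟨1, by omega⟩, ⟨2, by omega⟩, by simp, by simp [Fin.ext_iff]; omega,
      by simp [Fin.ext_iff]; omega⟩
  by_cases h1 : k.val = 1
  · exact ⟨⟨0, by omega⟩, ⟨2, by omega⟩, by simp, by simp [Fin.ext_iff]; omega,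
      by simp [Fin.ext_iff]; omega⟩
  · exact ⟨⟨0, by omega⟩, ⟨1, by omega⟩, by simp, by simp [Fin.ext_iff]; omega,
      by simp [Fin.ext_iff]; omega⟩

theorem pick2 (S : Setup x p pb m mb) (k l : Fin n) : ∃ a : Fin n, a ≠ k ∧ a ≠ l := by
  obtain ⟨a, b, hab, hak, hbk⟩ := S.pick k
  by_cases h : a = l
  · exact ⟨b, hbk, fun h' => hab (h.trans h'.symm)⟩
  · exact ⟨a, hak, h⟩

theorem x_le_p_self (S : Setup x p pb m mb) (j k) : x k ≤ p j k := by
  cases j with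
  | zero => rw [S.p0]
  | succ j => rw [S.ps]; exact le_sup_left

theorem pb_le_x_self (S : Setup x p pb m mb) (j k) : pb j k ≤ x k := S.dual.x_le_p_self j k

theorem x_le_p (S : Setup x p pb m mb) : ∀ j k i, x k ≤ p j i → k = i := by
  intro j
  induction j with
  | zero => intro k i h; rw [S.p0] at h; exact S.inj _ _ h
  | succ j ih =>
    intro k i h
    rw [S.ps] at h
    rcases S.jp _ _ _ h with h | h
    · exact S.inj _ _ h
    · obtain ⟨a, b, hab, h⟩ := S.mJ _ _ h
      exact absurd ((ih _ _ (h.trans inf_le_left)).symm.trans (ih _ _ (h.trans inf_le_right))) hab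

theorem x_le_m (S : Setup x p pb m mb) (j k) : ¬ x k ≤ m j := by
  intro h
  obtain ⟨a, b, hab, h⟩ := S.mJ _ _ h
  exact absurd ((S.x_le_p _ _ _ (h.trans inf_le_left)).symm.trans
    (S.x_le_p _ _ _ (h.trans inf_le_right))) hab

theorem mb_le_x (S : Setup x p pb m mb) (j k) : ¬ mb j ≤ x k := S.dual.x_le_m j k

theorem m_le_x (S : Setup x p pb m mb) (j k) : ¬ m j ≤ x k := by
  intro h
  obtain ⟨a, b, hab, hak, hbk⟩ := S.pick k
  rcases S.mp _ _ _ ((S.mle j a b hab).trans h) with h | h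
  · exact hak (S.inj _ _ ((S.x_le_p_self j a).trans h))
  · exact hbk (S.inj _ _ ((S.x_le_p_self j b).trans h))

theorem x_le_mb (S : Setup x p pb m mb) (j k) : ¬ x k ≤ mb j := S.dual.m_le_x j k

theorem m_mono (S : Setup x p pb m mb) : Monotone m := by
  refine monotone_nat_of_le_succ fun j => ?_
  have key : ∀ j, (∀ k, p j k ≤ p (j + 1) k) → m j ≤ m (j + 1) := fun j h =>
    S.mlub _ _ fun k l hkl => (inf_le_inf (h k) (h l)).trans (S.mle _ _ _ hkl)
  have : ∀ j k, p j k ≤ p (j + 1) k := by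
    intro j
    induction j with
    | zero => intro k; rw [S.p0, S.ps]; exact le_sup_left
    | succ j ih => intro k; rw [S.ps, S.ps]; exact sup_le_sup_left (key j ih) _
  exact key j (this j)

theorem mb_anti (S : Setup x p pb m mb) : Antitone mb := fun _ _ h => S.dual.m_mono h

/-- a pair of successor-level `p`s is below no generator. -/
theorem pp_le_x (S : Setup x p pb m mb) (j k l s) : ¬ p (j + 1) k ⊓ p (j + 1) l ≤ x s := by
  intro h
  rw [S.ps, S.ps] at h
  rcases S.mp _ _ _ h with h | h
  · exact S.m_le_x _ _ (le_sup_right.trans h)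
  · exact S.m_le_x _ _ (le_sup_right.trans h)

theorem x_le_xm (S : Setup x p pb m mb) (j k s) (h : x k ≤ x s ⊔ m j) : k = s := by
  rcases S.jp _ _ _ h with h | h
  · exact S.inj _ _ h
  · exact absurd h (S.x_le_m _ _)

/-- Claim S, relative to claim T at smaller index. -/
theorem claimS_aux (S : Setup x p pb m mb) (j : ℕ)
    (hT : ∀ c i, c < j → ¬ m j ≤ x i ⊔ m c) :
    ∀ j', j' ≤ j → ∀ k l, ¬ p (j + 1) k ⊓ p (j + 1) l ≤ m j' := by
  intro j'
  induction j' with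
  | zero =>
    intro _ k l h
    rcases S.mW _ _ _ h with h | h | ⟨s, t, _, h⟩
    · exact S.x_le_m _ _ ((S.x_le_p_self _ _).trans h)
    · exact S.x_le_m _ _ ((S.x_le_p_self _ _).trans h)
    · have h := h.trans inf_le_left
      rw [S.p0] at h
      exact S.pp_le_x _ _ _ _ h
  | succ c ih =>
    intro hc k l h
    rcases S.mW _ _ _ h with h | h | ⟨s, t, _, h⟩
    · exact S.x_le_m _ _ ((S.x_le_p_self _ _).trans h)
    · exact S.x_le_m _ _ ((S.x_le_p_self _ _).trans h)
    · have h := h.trans inf_le_left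
      rw [S.ps c] at h
      rcases S.W _ _ _ _ h with h | h | h | h
      · rw [S.ps] at h
        exact hT c s (by omega) (le_sup_right.trans h)
      · rw [S.ps] at h
        exact hT c s (by omega) (le_sup_right.trans h)
      · exact S.pp_le_x _ _ _ _ h
      · exact ih (by omega) _ _ h

theorem claimT (S : Setup x p pb m mb) : ∀ j c i, c < j → ¬ m j ≤ x i ⊔ m c := by
  intro j
  induction j with
  | zero => intro c i h; omega
  | succ j ih =>
    intro c i hc h
    obtain ⟨k, l, hkl, hki, hli⟩ := S.pick i
    rcases S.W _ _ _ _ ((S.mle _ k l hkl).trans h) with h | h | h | h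
    · exact hki (S.x_le_xm _ _ _ ((S.x_le_p_self _ _).trans h))
    · exact hli (S.x_le_xm _ _ _ ((S.x_le_p_self _ _).trans h))
    · exact S.pp_le_x _ _ _ _ h
    · exact S.claimS_aux j ih c (by omega) _ _ h

theorem claimS (S : Setup x p pb m mb) (j c k l) (h : c < j) : ¬ p j k ⊓ p j l ≤ m c := by
  obtain ⟨j, rfl⟩ : ∃ i, j = i + 1 := ⟨j - 1, by omega⟩
  exact S.claimS_aux j (S.claimT j) c (by omega) k l

theorem m_lt (S : Setup x p pb m mb) {c j} (h : c < j) : ¬ m j ≤ m c := fun h' =>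
  S.claimT j c ⟨0, by have := S.hn; omega⟩ h (h'.trans le_sup_right)

theorem claimT_dual (S : Setup x p pb m mb) (j c i) (h : c < j) : ¬ x i ⊓ mb c ≤ mb j :=
  S.dual.claimT j c i h

theorem claimS_dual (S : Setup x p pb m mb) (j c k l) (h : c < j) : ¬ mb c ≤ pb j k ⊔ pb j l :=
  S.dual.claimS j c k l h

theorem mb_lt (S : Setup x p pb m mb) {c j} (h : c < j) : ¬ mb c ≤ mb j := S.dual.m_lt h

theorem xmb_le_x (S : Setup x p pb m mb) (k i s) (h : x i ⊓ mb k ≤ x s) : i = s := by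
  rcases S.mp _ _ _ h with h | h
  · exact S.inj _ _ h
  · exact absurd h (S.mb_le_x _ _)

theorem claimA (S : Setup x p pb m mb) (k) (hM : ∀ J s, ¬ mb k ≤ x s ⊔ m J) :
    ∀ J i, ¬ x i ⊓ mb k ≤ m J := by
  intro J
  induction J with
  | zero =>
    intro i h
    rcases S.mW _ _ _ h with h | h | ⟨s, t, hst, h⟩
    · exact S.x_le_m _ _ h
    · exact hM 0 i (h.trans le_sup_right)
    · rw [S.p0, S.p0] at h
      exact hst ((S.xmb_le_x _ _ _ (h.trans inf_le_left)).symm.trans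
        (S.xmb_le_x _ _ _ (h.trans inf_le_right)))
  | succ J ih =>
    intro i h
    rcases S.mW _ _ _ h with h | h | ⟨s, t, hst, h⟩
    · exact S.x_le_m _ _ h
    · exact hM (J + 1) i (h.trans le_sup_right)
    · have key : ∀ s, s ≠ i → ¬ x i ⊓ mb k ≤ p (J + 1) s := by
        intro s hs h
        rw [S.ps] at h
        rcases S.W _ _ _ _ h with h | h | h | h
        · exact hs (S.x_le_xm _ _ _ h).symm
        · exact hM _ _ h
        · exact hs (S.xmb_le_x _ _ _ h).symm
        · exact ih _ h
      by_cases hs : s = i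
      · exact key t (fun ht => hst (hs.trans ht.symm)) (h.trans inf_le_right)
      · exact key s hs (h.trans inf_le_left)

theorem claimM (S : Setup x p pb m mb) : ∀ k J s, ¬ mb k ≤ x s ⊔ m J := by
  intro k
  induction k using Nat.strong_induction_on with
  | _ k ihk =>
  have hpb : ∀ J s i, i ≠ s → ¬ pb k i ≤ x s ⊔ m J := by
    intro J s i his h
    cases k with
    | zero => rw [S.pb0] at h; exact his (S.x_le_xm _ _ _ h)
    | succ k =>
      rw [S.pbs] at h
      rcases S.W _ _ _ _ h with h | h | h | h
      · exact his (S.x_le_xm _ _ _ h)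
      · exact ihk k (by omega) _ _ h
      · exact his (S.xmb_le_x _ _ _ h)
      · exact S.claimA k (ihk k (by omega)) _ _ h
  have hpp : ∀ J s a b, a ≠ b → ¬ pb k a ⊔ pb k b ≤ x s ⊔ m J := by
    intro J s a b hab h
    by_cases has : a = s
    · exact hpb J s b (fun hb => hab (has.trans hb.symm)) (le_sup_right.trans h)
    · exact hpb J s a has (le_sup_left.trans h)
  intro J
  induction J with
  | zero =>
    intro s h
    rcases S.mbW _ _ _ h with h | h | ⟨a, b, hab, h⟩
    · exact S.mb_le_x _ _ h
    · rcases S.mbm _ _ h with ⟨a, b, hab, h⟩ | ⟨a, b, hab, h⟩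
      · exact hpp 0 s a b hab (h.trans le_sup_right)
      · rw [S.p0] at h
        exact S.mb_le_x _ _ (h.trans inf_le_left)
    · exact hpp _ _ _ _ hab h
  | succ J ih =>
    intro s h
    rcases S.mbW _ _ _ h with h | h | ⟨a, b, hab, h⟩
    · exact S.mb_le_x _ _ h
    · rcases S.mbm _ _ h with ⟨a, b, hab, h⟩ | ⟨a, b, hab, h⟩
      · exact hpp (J + 1) s a b hab (h.trans le_sup_right)
      · rw [S.ps] at h
        exact ih _ (h.trans inf_le_left)
    · exact hpp _ _ _ _ hab h

theorem mb_le_m (S : Setup x p pb m mb) (k J) : ¬ mb k ≤ m J := fun h =>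
  S.claimM k J ⟨0, by have := S.hn; omega⟩ (h.trans le_sup_right)

theorem x_le_R (S : Setup x p pb m mb) (J c k s) (h : x k ≤ m J ⊔ mb c ⊔ x s) : k = s := by
  rcases S.jp _ _ _ h with h | h
  · rcases S.jp _ _ _ h with h | h
    · exact absurd h (S.x_le_m _ _)
    · exact absurd h (S.x_le_mb _ _)
  · exact S.inj _ _ h

theorem claim2 (S : Setup x p pb m mb) (J d s) : ∀ c, c < d → ¬ mb c ≤ m J ⊔ mb d ⊔ x s := by
  intro c
  induction c with
  | zero =>
    intro hc h
    rcases S.mbW _ _ _ h with h' | h' | ⟨a, b, hab, h'⟩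
    · rcases S.mbW _ _ _ h' with h | h | ⟨a, b, hab, h⟩
      · exact S.mb_le_m _ _ h
      · exact S.mb_lt hc h
      · rw [S.pb0] at h
        rcases S.jp _ _ _ (le_sup_left.trans h) with h | h
        · exact S.x_le_m _ _ h
        · exact S.x_le_mb _ _ h
    · exact S.mb_le_x _ _ h'
    · rw [S.pb0, S.pb0] at h'
      exact hab ((S.x_le_R _ _ _ _ (le_sup_left.trans h')).trans
        (S.x_le_R _ _ _ _ (le_sup_right.trans h')).symm)
  | succ c ih =>
    intro hc h
    have key : ∀ i, i ≠ s → ¬ pb (c + 1) i ≤ m J ⊔ mb d ⊔ x s := by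
      intro i his h
      rw [S.pbs] at h
      rcases S.W _ _ _ _ h with h | h | h' | h
      · exact his (S.x_le_R _ _ _ _ h)
      · exact ih (by omega) h
      · rcases S.W _ _ _ _ h' with h | h | h | h
        · exact his (S.x_le_R _ _ _ _ (h.trans le_sup_left))
        · exact ih (by omega) (h.trans le_sup_left)
        · exact S.claimA c (S.claimM c) _ _ h
        · exact S.claimT_dual _ _ _ (by omega) h
      · exact his (S.xmb_le_x _ _ _ h)
    have key2 : ∀ a b, a ≠ b → ¬ pb (c + 1) a ⊔ pb (c + 1) b ≤ m J ⊔ mb d ⊔ x s := by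
      intro a b hab h
      by_cases has : a = s
      · exact key b (fun hb => hab (has.trans hb.symm)) (le_sup_right.trans h)
      · exact key a has (le_sup_left.trans h)
    rcases S.mbW _ _ _ h with h' | h' | ⟨a, b, hab, h'⟩
    · rcases S.mbW _ _ _ h' with h | h | ⟨a, b, hab, h⟩
      · exact S.mb_le_m _ _ h
      · exact S.mb_lt hc h
      · exact key2 a b hab (h.trans le_sup_left)
    · exact S.mb_le_x _ _ h'
    · have hh := h'
      exact key2 a b hab hh

/-- `k, l, s` distinct. -/
theorem pp_le_pbpb (S : Setup x p pb m mb) (c d k l s) (hkl : k ≠ l) (hks : k ≠ s) (hls : l ≠ s) :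
    ¬ p (c + 1) k ⊓ p (c + 1) l ≤ pb (d + 1) k ⊔ pb (d + 1) s := by
  have hx : ∀ i, ¬ x i ≤ pb (d + 1) k ⊔ pb (d + 1) s := by
    intro i h
    rw [S.pbs, S.pbs] at h
    rcases S.jp _ _ _ h with h | h
    · exact S.x_le_mb _ _ (h.trans inf_le_right)
    · exact S.x_le_mb _ _ (h.trans inf_le_right)
  intro h
  rcases S.W _ _ _ _ h with h | h | h | h
  · exact hx _ ((S.x_le_p_self _ _).trans h)
  · exact hx _ ((S.x_le_p_self _ _).trans h)
  · exact S.pp_le_x _ _ _ _ (h.trans (S.pb_le_x_self _ _))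
  · exact S.pp_le_x _ _ _ _ (h.trans (S.pb_le_x_self _ _))

theorem m_le_pbpb (S : Setup x p pb m mb) (c d k s) (hks : k ≠ s) :
    ¬ m (c + 1) ≤ pb (d + 1) k ⊔ pb (d + 1) s := by
  intro h
  obtain ⟨l, hlk, hls⟩ := S.pick2 k s
  exact S.pp_le_pbpb c d k l s hlk.symm hks hls ((S.mle _ _ _ hlk.symm).trans h)

theorem claim4 (S : Setup x p pb m mb) (c d s) :
    ¬ m (c + 1) ≤ m c ⊔ mb (d + 1) ⊔ x s := by
  intro h
  obtain ⟨k, l, hkl, hks, hls⟩ := S.pick s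
  rcases S.W _ _ _ _ ((S.mle _ k l hkl).trans h) with h | h | h | h
  · exact hks (S.x_le_R _ _ _ _ ((S.x_le_p_self _ _).trans h))
  · exact hls (S.x_le_R _ _ _ _ ((S.x_le_p_self _ _).trans h))
  · rcases S.W _ _ _ _ h with h | h | h | h
    · exact hks (S.x_le_R _ _ _ _ (((S.x_le_p_self _ _).trans h).trans le_sup_left))
    · exact hls (S.x_le_R _ _ _ _ (((S.x_le_p_self _ _).trans h).trans le_sup_left))
    · exact S.claimS _ _ _ _ (by omega) h
    · exact S.pp_le_pbpb c d k l s hkl hks hls (h.trans (S.mble _ _ _ hks))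
  · exact S.pp_le_x _ _ _ _ h

theorem mbm_le_x (S : Setup x p pb m mb) (c d s) : ¬ mb c ⊓ m d ≤ x s := by
  intro h
  rcases S.mp _ _ _ h with h | h
  · exact S.mb_le_x _ _ h
  · exact S.m_le_x _ _ h

theorem mbm_le_m (S : Setup x p pb m mb) (c d) : ∀ e, e < d → ¬ mb c ⊓ m d ≤ m e := by
  intro e
  induction e with
  | zero =>
    intro he h
    rcases S.mW _ _ _ h with h | h | ⟨k, l, _, h⟩
    · exact S.mb_le_m _ _ h
    · exact S.m_lt he h
    · rw [S.p0] at h; exact S.mbm_le_x _ _ _ (h.trans inf_le_left)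
  | succ e ih =>
    intro he h
    rcases S.mW _ _ _ h with h | h | ⟨k, l, _, h⟩
    · exact S.mb_le_m _ _ h
    · exact S.m_lt he h
    · have h := h.trans inf_le_left
      rw [S.ps] at h
      rcases S.W _ _ _ _ h with h | h | h | h
      · exact S.claimM _ _ _ h
      · exact S.claimT _ _ _ (by omega) h
      · exact S.mbm_le_x _ _ _ h
      · exact ih (by omega) h

theorem mbm_le_mb (S : Setup x p pb m mb) (c d e) (h1 : c < e) : ¬ mb c ⊓ m (d + 1) ≤ mb e := by
  intro h
  obtain ⟨s, t, hst, -, -⟩ := S.pick ⟨0, by have := S.hn; omega⟩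
  obtain ⟨e, rfl⟩ : ∃ i, e = i + 1 := ⟨e - 1, by omega⟩
  rcases S.W _ _ _ _ (h.trans (S.mble _ _ _ hst)) with h | h | h | h
  · exact S.claimS_dual _ _ _ _ h1 h
  · exact S.m_le_pbpb _ _ _ _ hst h
  · exact S.mbm_le_x _ _ _ (h.trans (S.pb_le_x_self _ _))
  · exact S.mbm_le_x _ _ _ (h.trans (S.pb_le_x_self _ _))

/-! The five non-inequalities. -/

theorem five_x (S : Setup x p pb m mb) (s) :
    ¬ x s ≤ (m 1 ⊔ mb 3) ⊔ (mb 1 ⊓ m 3) ⊔ (m 2 ⊔ mb 4) ⊔ (mb 2 ⊓ m 4) := by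
  intro h
  rcases S.jp _ _ _ h with h | h
  · rcases S.jp _ _ _ h with h | h
    · rcases S.jp _ _ _ h with h | h
      · rcases S.jp _ _ _ h with h | h
        · exact S.x_le_m _ _ h
        · exact S.x_le_mb _ _ h
      · exact S.x_le_m _ _ (h.trans inf_le_right)
    · rcases S.jp _ _ _ h with h | h
      · exact S.x_le_m _ _ h
      · exact S.x_le_mb _ _ h
  · exact S.x_le_m _ _ (h.trans inf_le_right)

theorem five_a (S : Setup x p pb m mb) (s) :
    ¬ m 1 ⊔ mb 3 ≤ (mb 1 ⊓ m 3) ⊔ (m 2 ⊔ mb 4) ⊔ (mb 2 ⊓ m 4) ⊔ x s := by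
  intro h
  refine S.claim2 4 4 s 3 (by omega) ((le_sup_right.trans h).trans ?_)
  refine sup_le_sup_right ?_ _
  have h34 := S.m_mono (show 3 ≤ 4 by omega)
  have h24 := S.m_mono (show 2 ≤ 4 by omega)
  exact sup_le (sup_le ((inf_le_right.trans h34).trans le_sup_left) (sup_le_sup_right h24 _))
    (inf_le_right.trans le_sup_left)

theorem five_b (S : Setup x p pb m mb) (s) :
    ¬ m 2 ⊔ mb 4 ≤ (m 1 ⊔ mb 3) ⊔ (mb 1 ⊓ m 3) ⊔ (mb 2 ⊓ m 4) ⊔ x s := by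
  intro h
  refine S.claim4 1 0 s ((le_sup_left.trans h).trans ?_)
  refine sup_le_sup_right ?_ _
  have h13 := S.mb_anti (show 1 ≤ 3 by omega)
  have h12 := S.mb_anti (show 1 ≤ 2 by omega)
  exact sup_le (sup_le (sup_le_sup_left h13 _) (inf_le_left.trans le_sup_right))
    ((inf_le_left.trans h12).trans le_sup_right)

theorem five_a' (S : Setup x p pb m mb) (s) :
    ¬ mb 1 ⊓ m 3 ≤ (m 1 ⊔ mb 3) ⊔ (m 2 ⊔ mb 4) ⊔ (mb 2 ⊓ m 4) ⊔ x s := by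
  intro h
  have m12 := S.m_mono (show 1 ≤ 2 by omega)
  have m24 := S.m_mono (show 2 ≤ 4 by omega)
  have b12 := S.mb_anti (show 1 ≤ 2 by omega)
  have b23 := S.mb_anti (show 2 ≤ 3 by omega)
  have b34 := S.mb_anti (show 3 ≤ 4 by omega)
  have h : mb 1 ⊓ m 3 ≤ ((m 2 ⊔ mb 3) ⊔ (mb 2 ⊓ m 4)) ⊔ x s := by
    refine h.trans (sup_le_sup_right (sup_le_sup_right ?_ _) _)
    exact sup_le (sup_le_sup_right m12 _) (sup_le_sup_left b34 _)
  have n1 : ¬ mb 1 ≤ ((m 2 ⊔ mb 3) ⊔ (mb 2 ⊓ m 4)) ⊔ x s := by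
    intro h
    refine S.claim2 4 2 s 1 (by omega) (h.trans (sup_le_sup_right ?_ _))
    exact sup_le (sup_le_sup m24 b23) (inf_le_right.trans le_sup_left)
  have n2 : ¬ m 3 ≤ ((m 2 ⊔ mb 3) ⊔ (mb 2 ⊓ m 4)) ⊔ x s := by
    intro h
    refine S.claim4 2 1 s (h.trans (sup_le_sup_right ?_ _))
    exact sup_le (sup_le_sup_left b23 _) (inf_le_left.trans le_sup_right)
  rcases S.W _ _ _ _ h with h | h | h | h
  · exact n1 h
  · exact n2 h
  · rcases S.W _ _ _ _ h with h | h | h | h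
    · exact n1 (h.trans le_sup_left)
    · exact n2 (h.trans le_sup_left)
    · rcases S.W _ _ _ _ h with h | h | h | h
      · exact n1 ((h.trans le_sup_left).trans le_sup_left)
      · exact n2 ((h.trans le_sup_left).trans le_sup_left)
      · exact S.mbm_le_m _ _ _ (by omega) h
      · exact S.mbm_le_mb 1 2 3 (by omega) h
    · exact S.mbm_le_mb 1 2 2 (by omega) (h.trans inf_le_left)
  · exact S.mbm_le_x _ _ _ h

theorem five_b' (S : Setup x p pb m mb) (s) :
    ¬ mb 2 ⊓ m 4 ≤ (m 1 ⊔ mb 3) ⊔ (mb 1 ⊓ m 3) ⊔ (m 2 ⊔ mb 4) ⊔ x s := by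
  intro h
  have m12 := S.m_mono (show 1 ≤ 2 by omega)
  have m23 := S.m_mono (show 2 ≤ 3 by omega)
  have b13 := S.mb_anti (show 1 ≤ 3 by omega)
  have b34 := S.mb_anti (show 3 ≤ 4 by omega)
  have h : mb 2 ⊓ m 4 ≤ ((m 2 ⊔ mb 3) ⊔ (mb 1 ⊓ m 3)) ⊔ x s := by
    refine h.trans (sup_le_sup_right ?_ _)
    exact sup_le (sup_le_sup_right (sup_le_sup_right m12 _) _)
      ((sup_le_sup_left b34 _).trans le_sup_left)
  have n1 : ¬ mb 2 ≤ ((m 2 ⊔ mb 3) ⊔ (mb 1 ⊓ m 3)) ⊔ x s := by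
    intro h
    refine S.claim2 3 3 s 2 (by omega) (h.trans (sup_le_sup_right ?_ _))
    exact sup_le (sup_le_sup_right m23 _) (inf_le_right.trans le_sup_left)
  have n2 : ¬ m 4 ≤ ((m 2 ⊔ mb 3) ⊔ (mb 1 ⊓ m 3)) ⊔ x s := by
    intro h
    refine S.claim4 3 0 s (h.trans (sup_le_sup_right ?_ _))
    exact sup_le (sup_le_sup m23 b13) (inf_le_left.trans le_sup_right)
  rcases S.W _ _ _ _ h with h | h | h | h
  · exact n1 h
  · exact n2 h
  · rcases S.W _ _ _ _ h with h | h | h | h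
    · exact n1 (h.trans le_sup_left)
    · exact n2 (h.trans le_sup_left)
    · rcases S.W _ _ _ _ h with h | h | h | h
      · exact n1 ((h.trans le_sup_left).trans le_sup_left)
      · exact n2 ((h.trans le_sup_left).trans le_sup_left)
      · exact S.mbm_le_m _ _ _ (by omega) h
      · exact S.mbm_le_mb 2 3 3 (by omega) h
    · exact S.mbm_le_m _ _ 3 (by omega) (h.trans inf_le_right)
  · exact S.mbm_le_x _ _ _ h

end Setup

end KL

namespace KL

universe v w

/-- Lattice terms. -/
inductive Tm (ι : Type) : Type
  | var (i : ι) : Tm ι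
  | sup (s t : Tm ι) : Tm ι
  | inf (s t : Tm ι) : Tm ι

/-- Evaluation of lattice terms. -/
def Tm.eval {ι : Type} {L : Type*} [Lattice L] (g : ι → L) : Tm ι → L
  | .var i => g i
  | .sup s t => s.eval g ⊔ t.eval g
  | .inf s t => s.eval g ⊓ t.eval g

theorem exists_term {ι : Type} {L : Type*} [Lattice L] (g : ι → L) {z : L}
    (hz : z ∈ latticeClosure (Set.range g)) : ∃ t : Tm ι, t.eval g = z := by
  refine latticeClosure_min (t := {z | ∃ t : Tm ι, t.eval g = z}) ?_ ⟨?_, ?_⟩ hz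
  · rintro _ ⟨i, rfl⟩
    exact ⟨.var i, rfl⟩
  · rintro _ ⟨s, rfl⟩ _ ⟨t, rfl⟩
    exact ⟨.sup s t, rfl⟩
  · rintro _ ⟨s, rfl⟩ _ ⟨t, rfl⟩
    exact ⟨.inf s t, rfl⟩

/-- The Whitman condition. -/
def Whit (L : Type*) [Lattice L] : Prop :=
  ∀ s t u v : L, s ⊓ t ≤ u ⊔ v → s ≤ u ⊔ v ∨ t ≤ u ⊔ v ∨ s ⊓ t ≤ u ∨ s ⊓ t ≤ v

section ext
variable {ι : Type} {L : Type*} [Lattice L]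

theorem dich_up (g : ι → L) (i : ι) (c : L) (hc : ∀ j, j ≠ i → g j ≤ c) (t : Tm ι) :
    g i ≤ t.eval g ∨ t.eval g ≤ c := by
  induction t with
  | var j =>
    by_cases h : j = i
    · left; rw [h]; exact le_rfl
    · right; exact hc j h
  | sup s t hs ht =>
    rcases hs with h | hs
    · exact Or.inl (h.trans le_sup_left)
    rcases ht with h | ht
    · exact Or.inl (h.trans le_sup_right)
    exact Or.inr (sup_le hs ht)
  | inf s t hs ht =>
    rcases hs with hs | h
    · rcases ht with ht | h
      · exact Or.inl (le_inf hs ht)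
      · exact Or.inr (inf_le_right.trans h)
    · exact Or.inr (inf_le_left.trans h)

theorem dich_down (g : ι → L) (i : ι) (c : L) (hc : ∀ j, j ≠ i → c ≤ g j) (t : Tm ι) :
    t.eval g ≤ g i ∨ c ≤ t.eval g := by
  induction t with
  | var j =>
    by_cases h : j = i
    · left; rw [h]; exact le_rfl
    · right; exact hc j h
  | inf s t hs ht =>
    rcases hs with h | hs
    · exact Or.inl (inf_le_left.trans h)
    rcases ht with h | ht
    · exact Or.inl (inf_le_right.trans h)
    exact Or.inr (le_inf hs ht)
  | sup s t hs ht =>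
    rcases hs with hs | h
    · rcases ht with ht | h
      · exact Or.inl (sup_le hs ht)
      · exact Or.inr (h.trans le_sup_right)
    · exact Or.inr (h.trans le_sup_left)

theorem free_ext (hW : Whit L) (g c d : ι → L)
    (hc : ∀ i j, j ≠ i → g j ≤ c i) (hcn : ∀ i, ¬ g i ≤ c i)
    (hd : ∀ i j, j ≠ i → d i ≤ g j) (hdn : ∀ i, ¬ d i ≤ g i)
    {K : Type*} [Lattice K] (k : ι → K) (s : Tm ι) :
    ∀ t : Tm ι, s.eval g ≤ t.eval g → s.eval k ≤ t.eval k := by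
  induction s with
  | sup s1 s2 h1 h2 =>
    intro t h
    exact sup_le (h1 t (le_sup_left.trans h)) (h2 t (le_sup_right.trans h))
  | var i =>
    intro t
    induction t with
    | var j =>
      intro h
      by_cases hij : i = j
      · rw [hij]
      · exact absurd (h.trans (hc i j (Ne.symm hij))) (hcn i)
    | inf t1 t2 h1 h2 =>
      intro h
      exact le_inf (h1 (h.trans inf_le_left)) (h2 (h.trans inf_le_right))
    | sup t1 t2 h1 h2 =>
      intro h
      rcases dich_up g i (c i) (hc i) t1 with h' | h1'
      · exact (h1 h').trans le_sup_left
      rcases dich_up g i (c i) (hc i) t2 with h' | h2'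
      · exact (h2 h').trans le_sup_right
      exact absurd (h.trans (sup_le h1' h2')) (hcn i)
  | inf s1 s2 h1 h2 =>
    intro t
    induction t with
    | var i =>
      intro h
      rcases dich_down g i (d i) (hd i) s1 with h' | h1'
      · exact inf_le_left.trans (h1 _ h')
      rcases dich_down g i (d i) (hd i) s2 with h' | h2'
      · exact inf_le_right.trans (h2 _ h')
      exact absurd ((le_inf h1' h2').trans h) (hdn i)
    | inf t1 t2 h1 h2 =>
      intro h
      exact le_inf (h1 (h.trans inf_le_left)) (h2 (h.trans inf_le_right))
    | sup t1 t2 g1 g2 =>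
      intro h
      rcases hW _ _ _ _ h with h | h | h | h
      · exact inf_le_left.trans (h1 _ h)
      · exact inf_le_right.trans (h2 _ h)
      · exact (g1 h).trans le_sup_left
      · exact (g2 h).trans le_sup_right

theorem free_hom (hW : Whit L) (g c d : ι → L)
    (hc : ∀ i j, j ≠ i → g j ≤ c i) (hcn : ∀ i, ¬ g i ≤ c i)
    (hd : ∀ i j, j ≠ i → d i ≤ g j) (hdn : ∀ i, ¬ d i ≤ g i)
    {K : Type*} [Lattice K] (k : ι → K) (A : Set L) (hA : A ⊆ Set.range g) :
    ∃ φ : LatticeHom (genSub A) K, ∀ i (h : g i ∈ genSub A), φ ⟨g i, h⟩ = k i := by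
  have key := free_ext hW g c d hc hcn hd hdn k
  have keyeq : ∀ s t : Tm ι, s.eval g = t.eval g → s.eval k = t.eval k := fun s t h =>
    le_antisymm (key s t h.le) (key t s h.ge)
  have ex : ∀ z : genSub A, ∃ t : Tm ι, t.eval g = z := fun z =>
    exists_term g (latticeClosure_mono hA z.2)
  choose τ hτ using ex
  refine ⟨⟨⟨fun z => (τ z).eval k, fun y z => ?_⟩, fun y z => ?_⟩, fun i h => ?_⟩
  · exact keyeq _ (.sup (τ y) (τ z)) (by simp [Tm.eval, hτ])
  · exact keyeq _ (.inf (τ y) (τ z)) (by simp [Tm.eval, hτ])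
  · exact keyeq _ (.var i) (by simp [Tm.eval, hτ])

end ext

/-! Doubling (after Day) of an interval. -/

/-- The lattice obtained from `L` by doubling the interval from `a` to `b`. -/
def Dbl {L : Type*} [Lattice L] (a b : L) : Type _ :=
  {z : L × Prop // (z.2 → a ≤ z.1) ∧ (¬ z.2 → a ≤ z.1 → z.1 ≤ b)}

instance {L : Type*} [Lattice L] (a b : L) : PartialOrder (Dbl a b) :=
  inferInstanceAs (PartialOrder {z : L × Prop // _})

instance {L : Type v} [Lattice L] [Small.{w} L] (a b : L) : Small.{w} (Dbl a b) :=
  inferInstanceAs (Small.{w} {z : L × Prop // _})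

noncomputable instance {L : Type*} [Lattice L] (a b : L) : Lattice (Dbl a b) where
  sup y z := ⟨(y.1.1 ⊔ z.1.1, (y.1.2 ∨ z.1.2) ∨ (a ≤ y.1.1 ⊔ z.1.1 ∧ ¬ y.1.1 ⊔ z.1.1 ≤ b)), by
    refine ⟨?_, ?_⟩
    · rintro ((h | h) | h)
      · exact (y.2.1 h).trans le_sup_left
      · exact (z.2.1 h).trans le_sup_right
      · exact h.1
    · intro h h'
      by_contra h2
      exact h (Or.inr ⟨h', h2⟩)⟩
  le_sup_left y z := ⟨le_sup_left, fun h => Or.inl (Or.inl h)⟩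
  le_sup_right y z := ⟨le_sup_right, fun h => Or.inl (Or.inr h)⟩
  sup_le y z t hy hz := by
    refine ⟨sup_le hy.1 hz.1, ?_⟩
    rintro ((h | h) | h)
    · exact hy.2 h
    · exact hz.2 h
    · by_contra h'
      exact h.2 ((sup_le hy.1 hz.1).trans (t.2.2 h' (h.1.trans (sup_le hy.1 hz.1))))
  inf y z := ⟨(y.1.1 ⊓ z.1.1, y.1.2 ∧ z.1.2), by
    refine ⟨fun h => le_inf (y.2.1 h.1) (z.2.1 h.2), fun h h' => ?_⟩
    by_cases hy : y.1.2
    · have hz : ¬ z.1.2 := fun hz => h ⟨hy, hz⟩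
      exact inf_le_right.trans (z.2.2 hz (h'.trans inf_le_right))
    · exact inf_le_left.trans (y.2.2 hy (h'.trans inf_le_left))⟩
  inf_le_left y z := ⟨inf_le_left, fun h => h.1⟩
  inf_le_right y z := ⟨inf_le_right, fun h => h.2⟩
  le_inf y z t hy hz := ⟨le_inf hy.1 hz.1, fun h => ⟨hy.2 h, hz.2 h⟩⟩

section free

variable {F : Type v} [Lattice F] {n : ℕ} {x : Fin n → F}

theorem gen_ind (hg : latticeClosure (Set.range x) = Set.univ) (P : F → Prop)
    (h0 : ∀ i, P (x i)) (h1 : ∀ s t, P s → P t → P (s ⊔ t)) (h2 : ∀ s t, P s → P t → P (s ⊓ t))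
    (z : F) : P z := by
  have hz : z ∈ latticeClosure (Set.range x) := by rw [hg]; trivial
  refine latticeClosure_min (t := {z | P z}) ?_ ⟨?_, ?_⟩ hz
  · rintro _ ⟨i, rfl⟩
    exact h0 i
  · intro s hs t ht
    exact h1 s t hs ht
  · intro s hs t ht
    exact h2 s t hs ht

theorem free_small (hg : latticeClosure (Set.range x) = Set.univ) : Small.{w} F := by
  refine small_of_surjective (f := Tm.eval x) fun z => exists_term x ?_
  rw [hg]; trivial

theorem free_small_hom (hx : IsFreelyGenerated.{v, 0, w} x) {K : Type*} [Lattice K] [Small.{w} K]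
    (f : Fin n → K) : ∃ φ : LatticeHom F K, ∀ i, φ (x i) = f i := by
  let _ : Lattice (Shrink.{w} K) := (equivShrink K).symm.lattice
  obtain ⟨φ, hφ⟩ := hx.2 (Shrink.{w} K) (fun i => equivShrink K (f i))
  refine ⟨⟨⟨fun z => (equivShrink K).symm (φ z), fun y z => ?_⟩, fun y z => ?_⟩, fun i => ?_⟩
  · rw [map_sup]
    exact (equivShrink K).symm_apply_apply _
  · change (equivShrink K).symm (φ (y ⊓ z)) = _
    rw [map_inf]
    exact (equivShrink K).symm_apply_apply _
  · change (equivShrink K).symm (φ (x i)) = _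
    rw [hφ]; simp

theorem free_whit (hx : IsFreelyGenerated.{v, 0, w} x) : Whit F := by
  intro s t u v hst
  by_contra! hcon
  obtain ⟨h1, h2, h3, h4⟩ := hcon
  have : Small.{w} F := free_small hx.1
  obtain ⟨ψ, hψ⟩ := free_small_hom hx (K := Dbl (s ⊓ t) (u ⊔ v))
    (fun i => ⟨(x i, s ⊓ t ≤ x i ∧ ¬ x i ≤ u ⊔ v), fun h => h.1, fun h h' => by
      by_contra h2; exact h ⟨h', h2⟩⟩)
  have hid : ∀ z, (ψ z).1.1 = z := by
    refine gen_ind hx.1 _ (fun i => by rw [hψ]) (fun y z hy hz => ?_) (fun y z hy hz => ?_)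
    · rw [map_sup]
      change (ψ y).1.1 ⊔ (ψ z).1.1 = _
      rw [hy, hz]
    · rw [map_inf]
      change (ψ y).1.1 ⊓ (ψ z).1.1 = _
      rw [hy, hz]
  have hs : (ψ s).1.2 := by
    by_contra h
    have := (ψ s).2.2 h (by rw [hid]; exact inf_le_left)
    rw [hid] at this
    exact h1 this
  have ht : (ψ t).1.2 := by
    by_contra h
    have := (ψ t).2.2 h (by rw [hid]; exact inf_le_right)
    rw [hid] at this
    exact h2 this
  have hp : (ψ (s ⊓ t)).1.2 := by
    rw [map_inf]; exact ⟨hs, ht⟩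
  have hq : (ψ (u ⊔ v)).1.2 := (OrderHomClass.mono ψ hst).2 hp
  rw [map_sup] at hq
  rcases hq with (h | h) | h
  · have := (ψ u).2.1 h
    rw [hid] at this
    exact h3 this
  · have := (ψ v).2.1 h
    rw [hid] at this
    exact h4 this
  · rw [hid, hid] at h
    exact h.2 le_rfl

theorem free_jp (hx : IsFreelyGenerated.{v, 0, w} x) (i : Fin n) (s t : F) (h : x i ≤ s ⊔ t) :
    x i ≤ s ∨ x i ≤ t := by
  obtain ⟨φ, hφ⟩ := free_small_hom hx (K := Prop) (fun j => j = i)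
  have dich : ∀ z, φ z → x i ≤ z := by
    refine gen_ind hx.1 _ (fun j hj => ?_) (fun y z hy hz hyz => ?_) (fun y z hy hz hyz => ?_)
    · rw [hφ] at hj; rw [hj]
    · rw [map_sup] at hyz
      rcases hyz with h | h
      · exact (hy h).trans le_sup_left
      · exact (hz h).trans le_sup_right
    · rw [map_inf] at hyz
      exact le_inf (hy hyz.1) (hz hyz.2)
  have h2 : φ (s ⊔ t) := (OrderHomClass.mono φ h) (by rw [hφ])
  rw [map_sup] at h2
  exact h2.imp (dich s) (dich t)

theorem free_mp (hx : IsFreelyGenerated.{v, 0, w} x) (i : Fin n) (s t : F) (h : s ⊓ t ≤ x i) :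
    s ≤ x i ∨ t ≤ x i := by
  obtain ⟨φ, hφ⟩ := free_small_hom hx (K := Prop) (fun j => j ≠ i)
  have dich : ∀ z, ¬ φ z → z ≤ x i := by
    refine gen_ind hx.1 _ (fun j hj => ?_) (fun y z hy hz hyz => ?_) (fun y z hy hz hyz => ?_)
    · rw [hφ] at hj; rw [not_not.1 hj]
    · rw [map_sup] at hyz
      exact sup_le (hy fun h => hyz (Or.inl h)) (hz fun h => hyz (Or.inr h))
    · rw [map_inf] at hyz
      by_cases h : φ y
      · exact inf_le_right.trans (hz fun h' => hyz ⟨h, h'⟩)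
      · exact inf_le_left.trans (hy h)
  have h2 : ¬ φ (s ⊓ t) := fun h' => by
    have := (OrderHomClass.mono φ h) h'
    rw [hφ] at this
    exact this rfl
  rw [map_inf] at h2
  by_cases h : φ s
  · exact Or.inr (dich t fun h' => h2 ⟨h, h'⟩)
  · exact Or.inl (dich s h)

theorem free_inj (hx : IsFreelyGenerated.{v, 0, w} x) (i j : Fin n) (h : x i ≤ x j) : i = j := by
  obtain ⟨φ, hφ⟩ := free_small_hom hx (K := Prop) (fun j => j = i)
  have h2 : φ (x j) := (OrderHomClass.mono φ h) (by rw [hφ])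
  rw [hφ] at h2
  exact h2.symm

theorem free_irr (hx : IsFreelyGenerated.{v, 0, w} x) : ∀ u : F,
    (∀ s t, u = s ⊔ t → u = s ∨ u = t) → (∀ s t, u = s ⊓ t → u = s ∨ u = t) → ∃ i, u = x i := by
  refine gen_ind hx.1 _ (fun i _ _ => ⟨i, rfl⟩) (fun s t hs ht h1 h2 => ?_)
    (fun s t hs ht h1 h2 => ?_)
  · rcases h1 s t rfl with h | h
    · rw [h] at h1 h2 ⊢; exact hs h1 h2
    · rw [h] at h1 h2 ⊢; exact ht h1 h2
  · rcases h2 s t rfl with h | h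
    · rw [h] at h1 h2 ⊢; exact hs h1 h2
    · rw [h] at h1 h2 ⊢; exact ht h1 h2

theorem free_aut (hx : IsFreelyGenerated.{v, 0, w} x) (π : F ≃o F) (i : Fin n) :
    ∃ j, π (x i) = x j := by
  apply free_irr hx
  · intro s t h
    have h' : x i = π.symm s ⊔ π.symm t := by rw [← map_sup, ← h]; simp
    rcases free_jp hx _ _ _ h'.le with h2 | h2
    · left
      have : x i = π.symm s := le_antisymm h2 (h' ▸ le_sup_left)
      rw [this]; simp
    · right
      have : x i = π.symm t := le_antisymm h2 (h' ▸ le_sup_right)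
      rw [this]; simp
  · intro s t h
    have h' : x i = π.symm s ⊓ π.symm t := by rw [← map_inf, ← h]; simp
    rcases free_mp hx _ _ _ h'.ge with h2 | h2
    · left
      have : x i = π.symm s := le_antisymm (h' ▸ inf_le_left) h2
      rw [this]; simp
    · right
      have : x i = π.symm t := le_antisymm (h' ▸ inf_le_right) h2
      rw [this]; simp

/-! Finite joins. -/

theorem sup'_W {L α : Type*} [Lattice L] (X : L) (C : L → Prop)
    (hC : ∀ u v, C u → u ≤ v → C v)
    (hX : ∀ u v, X ≤ u ⊔ v → C (u ⊔ v) ∨ X ≤ u ∨ X ≤ v) (s : Finset α) (hs : s.Nonempty)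
    (f : α → L) (h : X ≤ s.sup' hs f) : C (s.sup' hs f) ∨ ∃ i ∈ s, X ≤ f i := by
  classical
  induction hs using Finset.Nonempty.cons_induction with
  | singleton a => right; exact ⟨a, by simp, by simpa using h⟩
  | cons a s ha hs ih =>
    rw [Finset.sup'_cons hs] at h ⊢
    rcases hX _ _ h with h | h | h
    · exact Or.inl h
    · exact Or.inr ⟨a, by simp, h⟩
    · rcases ih h with h | ⟨i, hi, h⟩
      · exact Or.inl (hC _ _ h le_sup_right)
      · exact Or.inr ⟨i, by simp [hi], h⟩

theorem m_le_iff (hn : 3 ≤ n) (j : ℕ) (z : F) :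
    freeM hn x j ≤ z ↔ ∀ k l, k ≠ l → freeP x j k ⊓ freeP x j l ≤ z := by
  refine (Finset.sup'_le_iff _ _).trans ?_
  simp

theorem le_m (hn : 3 ≤ n) (j : ℕ) (k l : Fin n) (h : k ≠ l) :
    freeP x j k ⊓ freeP x j l ≤ freeM hn x j := (m_le_iff hn j _).1 le_rfl k l h

theorem p_succ_le_iff (j : ℕ) (i : Fin n) (z : F) :
    freeP x (j + 1) i ≤ z ↔
      x i ≤ z ∧ ∀ k l, k ≠ l → k ≠ i → l ≠ i → freeP x j k ⊓ freeP x j l ≤ z := by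
  rw [freeP]
  rw [Finset.fold_op_rel_iff_and (r := fun a b : F => b ≤ a) (fun {_ _ _} => sup_le_iff)]
  simp only [Finset.mem_filter, Finset.mem_univ, true_and, Prod.forall]
  constructor
  · rintro ⟨h, h'⟩
    exact ⟨h, fun k l h1 h2 h3 => h' k l ⟨h1, h2, h3⟩⟩
  · rintro ⟨h, h'⟩
    exact ⟨h, fun k l h1 => h' k l h1.1 h1.2.1 h1.2.2⟩

theorem p_mono (j : ℕ) : ∀ i, freeP x j i ≤ freeP x (j + 1) i := by
  induction j with
  | zero => intro i; exact ((p_succ_le_iff 0 i _).1 le_rfl).1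
  | succ j ih =>
    intro i
    rw [p_succ_le_iff]
    have := (p_succ_le_iff (x := x) (j + 1) i _).1 le_rfl
    exact ⟨this.1, fun k l h1 h2 h3 => (inf_le_inf (ih k) (ih l)).trans (this.2 k l h1 h2 h3)⟩

theorem p_succ (hn : 3 ≤ n) (j : ℕ) (i : Fin n) : freeP x (j + 1) i = x i ⊔ freeM hn x j := by
  have := (p_succ_le_iff (x := x) j i _).1 le_rfl
  apply le_antisymm
  · rw [p_succ_le_iff]
    exact ⟨le_sup_left, fun k l h1 _ _ => (le_m hn j k l h1).trans le_sup_right⟩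
  · refine sup_le this.1 ((m_le_iff hn j _).2 fun k l hkl => ?_)
    by_cases hk : k = i
    · rw [hk]; exact inf_le_left.trans (p_mono j i)
    by_cases hl : l = i
    · rw [hl]; exact inf_le_right.trans (p_mono j i)
    exact this.2 k l hkl hk hl

theorem m_W (hn : 3 ≤ n) (j : ℕ) (X : F) (C : F → Prop)
    (hC : ∀ u v, C u → u ≤ v → C v)
    (hX : ∀ u v, X ≤ u ⊔ v → C (u ⊔ v) ∨ X ≤ u ∨ X ≤ v) (h : X ≤ freeM hn x j) :
    C (freeM hn x j) ∨ ∃ k l, k ≠ l ∧ X ≤ freeP x j k ⊓ freeP x j l := by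
  rcases sup'_W X C hC hX _ _ _ h with h | ⟨q, hq, h⟩
  · exact Or.inl h
  · exact Or.inr ⟨q.1, q.2, by simpa using hq, h⟩

/-! Symmetric elements. -/

theorem symm_m (hx : IsFreelyGenerated.{v, 0, w} x) (hn : 3 ≤ n) (j : ℕ) :
    IsSymmElem (freeM hn x j) := by
  have key : ∀ j, ∀ π : F ≃o F, π (freeM hn x j) ≤ freeM hn x j := by
    intro j
    induction j with
    | zero =>
      intro π
      rw [← OrderIso.le_symm_apply, m_le_iff]
      intro k l hkl
      rw [OrderIso.le_symm_apply, map_inf]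
      obtain ⟨k', hk⟩ := free_aut hx π k
      obtain ⟨l', hl⟩ := free_aut hx π l
      have hne : k' ≠ l' := fun h => hkl (free_inj hx _ _ (π.injective (by rw [hk, hl, h])).le)
      change π (x k) ⊓ π (x l) ≤ _
      rw [hk, hl]
      exact le_m hn 0 k' l' hne
    | succ j ih =>
      intro π
      rw [← OrderIso.le_symm_apply, m_le_iff]
      intro k l hkl
      rw [OrderIso.le_symm_apply, map_inf]
      obtain ⟨k', hk⟩ := free_aut hx π k
      obtain ⟨l', hl⟩ := free_aut hx π l
      have hne : k' ≠ l' := fun h => hkl (free_inj hx _ _ (π.injective (by rw [hk, hl, h])).le)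
      refine le_trans ?_ (le_m hn (j + 1) k' l' hne)
      rw [p_succ hn, p_succ hn, p_succ hn, p_succ hn, map_sup, map_sup, hk, hl]
      exact inf_le_inf (sup_le_sup_left (ih π) _) (sup_le_sup_left (ih π) _)
  intro π
  refine le_antisymm (key j π) ?_
  have := key j π.symm
  rwa [OrderIso.symm_apply_le] at this

theorem symm_bar (δ : F ≃o Fᵒᵈ) {u : F} (hu : IsSymmElem u) : IsSymmElem (dBar δ u) := by
  intro π
  have h := hu ((δ.trans π.dual).trans δ.symm)
  have h2 := congrArg δ h
  simp only [OrderIso.trans_apply, OrderIso.apply_symm_apply] at h2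
  exact h2

theorem symm_sup {u v : F} (hu : IsSymmElem u) (hv : IsSymmElem v) : IsSymmElem (u ⊔ v) := by
  intro π
  rw [map_sup, hu π, hv π]

/-! The dual automorphism. -/

theorem bar_le (δ : F ≃o Fᵒᵈ) {u v : F} : dBar δ u ≤ dBar δ v ↔ v ≤ u :=
  (OrderDual.toDual_le_toDual (a := dBar δ v) (b := dBar δ u)).symm.trans δ.le_iff_le

theorem bar_sup (δ : F ≃o Fᵒᵈ) (u v : F) : dBar δ (u ⊔ v) = dBar δ u ⊓ dBar δ v := by
  unfold dBar; rw [map_sup]; rfl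

theorem bar_inf (δ : F ≃o Fᵒᵈ) (u v : F) : dBar δ (u ⊓ v) = dBar δ u ⊔ dBar δ v := by
  unfold dBar; rw [map_inf]; rfl

theorem bar_bar (hg : latticeClosure (Set.range x) = Set.univ) (δ : F ≃o Fᵒᵈ)
    (hδ : ∀ i, dBar δ (x i) = x i) (u : F) : dBar δ (dBar δ u) = u := by
  refine gen_ind hg (fun u => dBar δ (dBar δ u) = u) (fun i => by rw [hδ, hδ]) (fun s t hs ht => ?_) (fun s t hs ht => ?_) u
  · rw [bar_sup, bar_inf, hs, ht]
  · rw [bar_inf, bar_sup, hs, ht]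

theorem setup (hx : IsFreelyGenerated.{v, 0, w} x) (hn : 3 ≤ n) (δ : F ≃o Fᵒᵈ)
    (hδ : ∀ i, dBar δ (x i) = x i) :
    Setup x (freeP x) (fun j i => dBar δ (freeP x j i)) (freeM hn x)
      (fun j => dBar δ (freeM hn x j)) := by
  have bb := bar_bar hx.1 δ hδ
  have le_bar : ∀ u v, u ≤ dBar δ v ↔ v ≤ dBar δ u := fun u v => by
    rw [← bar_le δ, bb]
  have bar_le' : ∀ u v, dBar δ u ≤ v ↔ dBar δ v ≤ u := fun u v => by
    rw [← bar_le δ, bb]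
  have mW : ∀ j (u v : F), u ⊓ v ≤ freeM hn x j → u ≤ freeM hn x j ∨ v ≤ freeM hn x j ∨
      ∃ k l, k ≠ l ∧ u ⊓ v ≤ freeP x j k ⊓ freeP x j l := by
    intro j u v h
    rw [← or_assoc]
    refine m_W hn j (u ⊓ v) (fun z => u ≤ z ∨ v ≤ z)
      (fun a b h hab => h.imp (fun h => h.trans hab) (fun h => h.trans hab)) (fun a b h => ?_) h
    rcases free_whit hx _ _ _ _ h with h | h | h
    · exact Or.inl (Or.inl h)
    · exact Or.inl (Or.inr h)
    · exact Or.inr h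
  have mJ : ∀ j i, x i ≤ freeM hn x j → ∃ k l, k ≠ l ∧ x i ≤ freeP x j k ⊓ freeP x j l := by
    intro j i h
    rcases m_W hn j (x i) (fun z => False) (fun _ _ h _ => h)
      (fun u v h => Or.inr (free_jp hx _ _ _ h)) h with h | h
    · exact h.elim
    · exact h
  have mbW : ∀ j (u v : F), dBar δ (freeM hn x j) ≤ u ⊔ v → dBar δ (freeM hn x j) ≤ u ∨
      dBar δ (freeM hn x j) ≤ v ∨
      ∃ k l, k ≠ l ∧ dBar δ (freeP x j k) ⊔ dBar δ (freeP x j l) ≤ u ⊔ v := by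
    intro j u v h
    rw [bar_le', bar_sup] at h
    rcases mW _ _ _ h with h | h | ⟨k, l, hkl, h⟩
    · exact Or.inl ((bar_le' _ _).2 h)
    · exact Or.inr (Or.inl ((bar_le' _ _).2 h))
    · refine Or.inr (Or.inr ⟨k, l, hkl, ?_⟩)
      rw [← bar_inf, bar_le', bar_sup]; exact h
  exact
    { hn := hn
      W := free_whit hx
      jp := free_jp hx
      mp := free_mp hx
      inj := free_inj hx
      p0 := fun i => rfl
      ps := p_succ hn
      pb0 := hδ
      pbs := fun j i => by rw [p_succ hn, bar_sup, hδ]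
      mle := le_m hn
      mble := fun j k l h => by rw [← bar_inf, bar_le]; exact le_m hn j k l h
      mlub := fun j z h => (m_le_iff hn j z).2 h
      mbglb := fun j z h => by
        rw [le_bar, m_le_iff]
        intro k l hkl
        rw [le_bar, bar_inf]; exact h k l hkl
      mW := mW
      mbW := mbW
      mJ := mJ
      mbJ := fun j i h => by
        rw [bar_le', hδ] at h
        obtain ⟨k, l, hkl, h⟩ := mJ _ _ h
        refine ⟨k, l, hkl, ?_⟩
        rw [← bar_inf, bar_le', hδ]; exact h
      mbm := fun c j h => by
        refine m_W hn j _
          (fun z => ∃ k l, k ≠ l ∧ dBar δ (freeP x c k) ⊔ dBar δ (freeP x c l) ≤ z)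
          (fun a b ⟨k, l, hkl, h⟩ hab => ⟨k, l, hkl, h.trans hab⟩) (fun u v h => ?_) h
        rcases mbW _ _ _ h with h | h | h
        · exact Or.inr (Or.inl h)
        · exact Or.inr (Or.inr h)
        · exact Or.inl h }

end free

end KL

theorem key_lemma {n : ℕ} (hn : 3 ≤ n) {F : Type*} [Lattice F] (x : Fin n → F)
    (hx : IsFreelyGenerated x) (δ : F ≃o Fᵒᵈ) (hδ : ∀ i, dBar δ (x i) = x i) :
    (∀ j : ℕ, IsSymmElem (freeM hn x j) ∧ IsSymmElem (dBar δ (freeM hn x j))) ∧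
    IsSymmElem (aElem hn x δ) ∧ IsSymmElem (dBar δ (aElem hn x δ)) ∧
    IsSymmElem (bElem hn x δ) ∧ IsSymmElem (dBar δ (bElem hn x δ)) ∧
    ({aElem hn x δ, dBar δ (aElem hn x δ), bElem hn x δ, dBar δ (bElem hn x δ),
        x ⟨0, by omega⟩} : Set F).ncard = 5 ∧
    ∀ (K : Type*) [Lattice K] (k₁ k₂ k₃ k₄ k₅ : K),
      ∃ φ : LatticeHom (genSub ({aElem hn x δ, dBar δ (aElem hn x δ), bElem hn x δ,
          dBar δ (bElem hn x δ), x ⟨0, by omega⟩} : Set F)) K,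
        φ ⟨aElem hn x δ, subset_latticeClosure (by simp)⟩ = k₁ ∧
        φ ⟨dBar δ (aElem hn x δ), subset_latticeClosure (by simp)⟩ = k₂ ∧
        φ ⟨bElem hn x δ, subset_latticeClosure (by simp)⟩ = k₃ ∧
        φ ⟨dBar δ (bElem hn x δ), subset_latticeClosure (by simp)⟩ = k₄ ∧
        φ ⟨x ⟨0, by omega⟩, subset_latticeClosure (by simp)⟩ = k₅ := by
  have sm := KL.symm_m hx hn
  have sa : IsSymmElem (aElem hn x δ) := KL.symm_sup (sm 1) (KL.symm_bar δ (sm 3))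
  have sb : IsSymmElem (bElem hn x δ) := KL.symm_sup (sm 2) (KL.symm_bar δ (sm 4))
  have S := KL.setup hx hn δ hδ
  have bb := KL.bar_bar hx.1 δ hδ
  have ha' : dBar δ (aElem hn x δ) = dBar δ (freeM hn x 1) ⊓ freeM hn x 3 := by
    unfold aElem; rw [KL.bar_sup, bb]
  have hb' : dBar δ (bElem hn x δ) = dBar δ (freeM hn x 2) ⊓ freeM hn x 4 := by
    unfold bElem; rw [KL.bar_sup, bb]
  have f1 := S.five_a ⟨0, by omega⟩
  have f2 := S.five_a' ⟨0, by omega⟩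
  have f3 := S.five_b ⟨0, by omega⟩
  have f4 := S.five_b' ⟨0, by omega⟩
  have f5 := S.five_x ⟨0, by omega⟩
  simp only [← ha', ← hb'] at f1 f2 f3 f4 f5
  change ¬ aElem hn x δ ≤ _ ⊔ bElem hn x δ ⊔ _ ⊔ _ at f1
  change ¬ _ ≤ aElem hn x δ ⊔ bElem hn x δ ⊔ _ ⊔ _ at f2
  change ¬ bElem hn x δ ≤ aElem hn x δ ⊔ _ ⊔ _ ⊔ _ at f3
  change ¬ _ ≤ aElem hn x δ ⊔ _ ⊔ bElem hn x δ ⊔ _ at f4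
  change ¬ _ ≤ aElem hn x δ ⊔ _ ⊔ bElem hn x δ ⊔ _ at f5
  refine ⟨fun j => ⟨sm j, KL.symm_bar δ (sm j)⟩, sa, KL.symm_bar δ sa, sb, KL.symm_bar δ sb, ?_⟩
  have hx0 := hδ ⟨0, by omega⟩
  have hW : KL.Whit F := S.W
  clear S ha' hb'
  generalize aElem hn x δ = a at *
  generalize bElem hn x δ = b at *
  generalize x ⟨0, by omega⟩ = z at *
  have ba := bb a
  have bbb := bb b
  generalize ha' : dBar δ a = a' at *
  generalize hb' : dBar δ b = b' at *
  let g : Fin 5 → F := ![a, a', b, b', z]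
  let c : Fin 5 → F := ![a' ⊔ b ⊔ b' ⊔ z, a ⊔ b ⊔ b' ⊔ z, a ⊔ a' ⊔ b' ⊔ z, a ⊔ a' ⊔ b ⊔ z,
    a ⊔ a' ⊔ b ⊔ b']
  let d : Fin 5 → F := ![a' ⊓ b ⊓ b' ⊓ z, a ⊓ b ⊓ b' ⊓ z, a ⊓ a' ⊓ b' ⊓ z, a ⊓ a' ⊓ b ⊓ z,
    a ⊓ a' ⊓ b ⊓ b']
  have hcn : ∀ i, ¬ g i ≤ c i := by
    intro i
    fin_cases i
    · exact f1
    · exact f2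
    · exact f3
    · exact f4
    · exact f5
  have hc : ∀ i j, j ≠ i → g j ≤ c i := by
    intro i j hij
    fin_cases i <;> fin_cases j <;> first
      | exact absurd rfl hij
      | exact le_sup_right
      | exact le_sup_right.trans le_sup_left
      | exact (le_sup_right.trans le_sup_left).trans le_sup_left
      | exact (le_sup_left.trans le_sup_left).trans le_sup_left
  have hd : ∀ i j, j ≠ i → d i ≤ g j := by
    intro i j hij
    fin_cases i <;> fin_cases j <;> first
      | exact absurd rfl hij
      | exact inf_le_right
      | exact inf_le_left.trans inf_le_right
      | exact inf_le_left.trans (inf_le_left.trans inf_le_right)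
      | exact inf_le_left.trans (inf_le_left.trans inf_le_left)
  have hdn : ∀ i, ¬ d i ≤ g i := by
    intro i h
    rw [← KL.bar_le δ] at h
    fin_cases i
    · change dBar δ a ≤ dBar δ (a' ⊓ b ⊓ b' ⊓ z) at h
      simp only [KL.bar_inf, ha', hb', ba, bbb, hx0] at h
      exact f2 (h.trans (le_of_eq (by ac_rfl)))
    · change dBar δ a' ≤ dBar δ (a ⊓ b ⊓ b' ⊓ z) at h
      simp only [KL.bar_inf, ha', hb', ba, bbb, hx0] at h
      exact f1 (h.trans (le_of_eq (by ac_rfl)))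
    · change dBar δ b ≤ dBar δ (a ⊓ a' ⊓ b' ⊓ z) at h
      simp only [KL.bar_inf, ha', hb', ba, bbb, hx0] at h
      exact f4 (h.trans (le_of_eq (by ac_rfl)))
    · change dBar δ b' ≤ dBar δ (a ⊓ a' ⊓ b ⊓ z) at h
      simp only [KL.bar_inf, ha', hb', ba, bbb, hx0] at h
      exact f3 (h.trans (le_of_eq (by ac_rfl)))
    · change dBar δ z ≤ dBar δ (a ⊓ a' ⊓ b ⊓ b') at h
      simp only [KL.bar_inf, ha', hb', ba, bbb, hx0] at h
      exact f5 (h.trans (le_of_eq (by ac_rfl)))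
  have ginj : Function.Injective g := by
    intro i j h
    by_contra hij
    exact hcn i (h.le.trans (hc i j (Ne.symm hij)))
  have hr : ({a, a', b, b', z} : Set F) = Set.range g := by
    simp only [g, Matrix.range_cons, Matrix.range_empty, Set.union_empty, Set.singleton_union]
  refine ⟨?_, ?_⟩
  · rw [hr, ← Set.image_univ, Set.ncard_image_of_injective _ ginj, Set.ncard_univ]
    simp
  · intro K _ k₁ k₂ k₃ k₄ k₅
    obtain ⟨φ, hφ⟩ := KL.free_hom hW g c d hc hcn hd hdn ![k₁, k₂, k₃, k₄, k₅] _ hr.subset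
    exact ⟨φ, hφ 0 _, hφ 1 _, hφ 2 _, hφ 3 _, hφ 4 _⟩
end

section
/- Let s := ⨆ over i < n of (⨅ over i' ≠ i of x i'). Then s is a symmetric element of F, (⨅ over i < n of x i) < s, and every symmetric element t of F with t ≠ ⨅ over i < n of x i and t ≠ ⨆ over i < n of x i satisfies s ≤ t and t ≤ s̄ (where s̄ = δ s). Consequently, s is the unique atom and s̄ the unique coatom of the lattice of symmetric elements of F. -/
open Cardinal

universe u

/-- `⨅ i < n, x i`. -/
def infGen {n : ℕ} {F : Type*} [Lattice F] (hn : 3 ≤ n) (x : Fin n → F) : F :=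
  Finset.univ.inf' ⟨⟨0, by omega⟩, Finset.mem_univ _⟩ x

/-- `⨆ i < n, x i`. -/
def supGen {n : ℕ} {F : Type*} [Lattice F] (hn : 3 ≤ n) (x : Fin n → F) : F :=
  Finset.univ.sup' ⟨⟨0, by omega⟩, Finset.mem_univ _⟩ x

/-- `s := ⨆ i < n, ⨅ i' ≠ i, x i'`. -/
def sElem {n : ℕ} {F : Type*} [Lattice F] (hn : 3 ≤ n) (x : Fin n → F) : F :=
  Finset.univ.sup' ⟨⟨0, by omega⟩, Finset.mem_univ _⟩ fun i =>
    (Finset.univ.erase i).inf'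
      (by
        apply Finset.card_pos.mp
        rw [Finset.card_erase_of_mem (Finset.mem_univ _), Finset.card_univ, Fintype.card_fin]
        omega) x

namespace UA

universe w

/-- Induction principle for a generated lattice. -/
theorem gen_induction {ι F : Type*} [Lattice F] {x : ι → F}
    (h : latticeClosure (Set.range x) = Set.univ) (p : F → Prop)
    (h0 : ∀ i, p (x i)) (hs : ∀ a b, p a → p b → p (a ⊔ b)) (hi : ∀ a b, p a → p b → p (a ⊓ b))
    (t : F) : p t := by
  have ht : t ∈ latticeClosure (Set.range x) := by rw [h]; trivial
  refine latticeClosure_sup_inf_induction (fun a _ => p a) ?_ ?_ ?_ ht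
  · rintro a ⟨i, rfl⟩; exact h0 i
  · intro a _ b _; exact hs a b
  · intro a _ b _; exact hi a b

theorem dichotomy {ι F : Type*} [Lattice F] {x : ι → F}
    (h : latticeClosure (Set.range x) = Set.univ) (A B : Finset ι) (hA : A.Nonempty)
    (hB : B.Nonempty) (hAB : ∀ i, i ∈ A ∨ i ∈ B) (t : F) :
    A.inf' hA x ≤ t ∨ t ≤ B.sup' hB x := by
  refine gen_induction h (fun t => A.inf' hA x ≤ t ∨ t ≤ B.sup' hB x) ?_ ?_ ?_ t
  · intro i
    rcases hAB i with hi | hi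
    · exact Or.inl (Finset.inf'_le x hi)
    · exact Or.inr (Finset.le_sup' x hi)
  · rintro a b (ha | ha) (hb | hb)
    · exact Or.inl (ha.trans le_sup_left)
    · exact Or.inl (ha.trans le_sup_left)
    · exact Or.inl (hb.trans le_sup_right)
    · exact Or.inr (sup_le ha hb)
  · rintro a b (ha | ha) (hb | hb)
    · exact Or.inl (le_inf ha hb)
    · exact Or.inr (inf_le_right.trans hb)
    · exact Or.inr (inf_le_left.trans ha)
    · exact Or.inr (inf_le_left.trans ha)

theorem not_inf_le_sup {ι F : Type*} [Lattice F] {x : ι → F} (h : IsFreelyGenerated x)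
    (A B : Finset ι) (hA : A.Nonempty) (hB : B.Nonempty) (hAB : ∀ i, i ∈ A → i ∉ B) :
    ¬ A.inf' hA x ≤ B.sup' hB x := by
  classical
  intro hle
  obtain ⟨φ, hφ⟩ := h.2 (Set PUnit) (fun i => if i ∈ A then Set.univ else ∅)
  have h1 : φ (A.inf' hA x) ≤ φ (B.sup' hB x) := OrderHomClass.mono φ hle
  rw [map_finset_inf', map_finset_sup'] at h1
  have h2 : (Set.univ : Set PUnit) ≤ A.inf' hA (φ ∘ x) := by
    refine Finset.le_inf' _ _ fun i hi => ?_
    simp [hφ, hi]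
  have h3 : B.sup' hB (φ ∘ x) ≤ (∅ : Set PUnit) := by
    refine Finset.sup'_le _ _ fun i hi => ?_
    have : i ∉ A := fun h => hAB i h hi
    simp [hφ, this]
  exact (h2.trans (h1.trans h3)) (Set.mem_univ PUnit.unit)

/-- Lattice terms. -/
inductive Tm (ι : Type) : Type
  | var : ι → Tm ι
  | join : Tm ι → Tm ι → Tm ι
  | meet : Tm ι → Tm ι → Tm ι

/-- Evaluation of lattice terms. -/
def Tm.ev {ι : Type} {F : Type*} [Lattice F] (x : ι → F) : Tm ι → F
  | .var i => x i
  | .join a b => a.ev x ⊔ b.ev x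
  | .meet a b => a.ev x ⊓ b.ev x

theorem small_of_gen {ι : Type} {F : Type*} [Lattice F] {x : ι → F}
    (h : latticeClosure (Set.range x) = Set.univ) : Small.{w} F := by
  have : Function.Surjective (Tm.ev x) := by
    intro t
    refine gen_induction h (fun t => ∃ a, Tm.ev x a = t) ?_ ?_ ?_ t
    · intro i; exact ⟨.var i, rfl⟩
    · rintro _ _ ⟨a, rfl⟩ ⟨b, rfl⟩; exact ⟨.join a b, rfl⟩
    · rintro _ _ ⟨a, rfl⟩ ⟨b, rfl⟩; exact ⟨.meet a b, rfl⟩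
  exact small_of_surjective this

theorem exists_endo {ι : Type} {F : Type*} [Lattice F] {x : ι → F} (h : IsFreelyGenerated x)
    (f : ι → F) : ∃ φ : LatticeHom F F, ∀ i, φ (x i) = f i := by
  have := small_of_gen h.1
  let e := equivShrink F
  let : Max (Shrink F) := ⟨fun a b => e (e.symm a ⊔ e.symm b)⟩
  let : Min (Shrink F) := ⟨fun a b => e (e.symm a ⊓ e.symm b)⟩
  let : LE (Shrink F) := ⟨fun a b => e.symm a ≤ e.symm b⟩
  let : LT (Shrink F) := ⟨fun a b => e.symm a < e.symm b⟩
  let : Lattice (Shrink F) := Function.Injective.lattice e.symm e.symm.injective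
    Iff.rfl Iff.rfl (fun a b => e.symm_apply_apply _) (fun a b => e.symm_apply_apply _)
  obtain ⟨φ, hφ⟩ := h.2 (Shrink F) (fun i => e (f i))
  refine ⟨⟨⟨fun t => e.symm (φ t), ?_⟩, ?_⟩, ?_⟩
  · intro a b
    rw [map_sup]
    exact e.symm_apply_apply _
  · intro a b
    change e.symm (φ (a ⊓ b)) = _
    rw [map_inf]
    exact e.symm_apply_apply _
  · intro i
    change e.symm (φ (x i)) = _
    rw [hφ]
    exact e.symm_apply_apply _

theorem exists_auto {ι : Type} {F : Type*} [Lattice F] {x : ι → F} (h : IsFreelyGenerated x)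
    (σ : Equiv.Perm ι) : ∃ π : F ≃o F, ∀ i, π (x i) = x (σ i) := by
  obtain ⟨φ, hφ⟩ := exists_endo h (fun i => x (σ i))
  obtain ⟨ψ, hψ⟩ := exists_endo h (fun i => x (σ.symm i))
  have h1 : ∀ t, ψ (φ t) = t := by
    refine gen_induction h.1 _ ?_ ?_ ?_
    · intro i; simp [hφ, hψ]
    · intro a b ha hb; simp [ha, hb]
    · intro a b ha hb; simp [ha, hb]
  have h2 : ∀ t, φ (ψ t) = t := by
    refine gen_induction h.1 _ ?_ ?_ ?_
    · intro i; simp [hφ, hψ]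
    · intro a b ha hb; simp [ha, hb]
    · intro a b ha hb; simp [ha, hb]
  refine ⟨⟨⟨φ, ψ, h1, h2⟩, ?_⟩, hφ⟩
  intro a b
  constructor
  · intro hab
    have : ψ (φ a) ≤ ψ (φ b) := OrderHomClass.mono ψ hab
    rwa [h1, h1] at this
  · intro hab
    exact OrderHomClass.mono φ hab

theorem erase_ne {n : ℕ} (hn : 3 ≤ n) (i : Fin n) : (Finset.univ.erase i).Nonempty := by
  apply Finset.card_pos.mp
  rw [Finset.card_erase_of_mem (Finset.mem_univ _), Finset.card_univ, Fintype.card_fin]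
  omega

variable {n : ℕ} {F : Type*} [Lattice F] {x : Fin n → F}

theorem gen_sup_irred (hn : 3 ≤ n) (hx : IsFreelyGenerated x) (i : Fin n) (a b : F)
    (h : a ⊔ b = x i) : a = x i ∨ b = x i := by
  have ha : a ≤ x i := h ▸ le_sup_left
  have hb : b ≤ x i := h ▸ le_sup_right
  have key := dichotomy hx.1 {i} (Finset.univ.erase i) (Finset.singleton_nonempty i)
    (erase_ne hn i) (by intro j; by_cases hj : j = i <;> simp [hj])
  rcases key a with h1 | h1
  · exact Or.inl (le_antisymm ha (by simpa using h1))
  rcases key b with h2 | h2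
  · exact Or.inr (le_antisymm hb (by simpa using h2))
  refine absurd ?_ (not_inf_le_sup hx {i} (Finset.univ.erase i) (Finset.singleton_nonempty i)
    (erase_ne hn i) (by simp))
  rw [Finset.inf'_singleton, ← h]
  exact sup_le h1 h2

theorem gen_inf_irred (hn : 3 ≤ n) (hx : IsFreelyGenerated x) (i : Fin n) (a b : F)
    (h : a ⊓ b = x i) : a = x i ∨ b = x i := by
  have ha : x i ≤ a := h ▸ inf_le_left
  have hb : x i ≤ b := h ▸ inf_le_right
  have key := dichotomy hx.1 (Finset.univ.erase i) {i} (erase_ne hn i)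
    (Finset.singleton_nonempty i) (by intro j; by_cases hj : j = i <;> simp [hj])
  rcases key a with h1 | h1
  swap
  · exact Or.inl (le_antisymm (by simpa using h1) ha)
  rcases key b with h2 | h2
  swap
  · exact Or.inr (le_antisymm (by simpa using h2) hb)
  refine absurd ?_ (not_inf_le_sup hx (Finset.univ.erase i) {i} (erase_ne hn i)
    (Finset.singleton_nonempty i) (by simp))
  rw [Finset.sup'_singleton, ← h]
  exact le_inf h1 h2

theorem gen_inj (hx : IsFreelyGenerated x) : Function.Injective x := by
  intro i j hij
  by_contra hne
  refine not_inf_le_sup hx {i} {j} (Finset.singleton_nonempty i) (Finset.singleton_nonempty j)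
    (by simpa using hne) ?_
  simp [hij]

theorem eq_gen (hx : IsFreelyGenerated x) (t : F)
    (hs : ∀ a b, a ⊔ b = t → a = t ∨ b = t) (hi : ∀ a b, a ⊓ b = t → a = t ∨ b = t) :
    ∃ i, t = x i := by
  have : ∀ t, (∃ i, t = x i) ∨ (∃ a b, a ⊔ b = t ∧ a ≠ t ∧ b ≠ t) ∨
      (∃ a b, a ⊓ b = t ∧ a ≠ t ∧ b ≠ t) := by
    refine gen_induction hx.1 _ (fun i => Or.inl ⟨i, rfl⟩) ?_ ?_
    · intro a b ha hb
      by_cases h1 : a = a ⊔ b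
      · rw [← h1]; exact ha
      by_cases h2 : b = a ⊔ b
      · rw [← h2]; exact hb
      exact Or.inr (Or.inl ⟨a, b, rfl, h1, h2⟩)
    · intro a b ha hb
      by_cases h1 : a = a ⊓ b
      · rw [← h1]; exact ha
      by_cases h2 : b = a ⊓ b
      · rw [← h2]; exact hb
      exact Or.inr (Or.inr ⟨a, b, rfl, h1, h2⟩)
  rcases this t with h | ⟨a, b, h, h1, h2⟩ | ⟨a, b, h, h1, h2⟩
  · exact h
  · rcases hs a b h with h3 | h3 <;> contradiction
  · rcases hi a b h with h3 | h3 <;> contradiction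

theorem auto_perm (hn : 3 ≤ n) (hx : IsFreelyGenerated x) (π : F ≃o F) (i : Fin n) :
    ∃ j, π (x i) = x j := by
  refine eq_gen hx _ ?_ ?_
  · intro a b h
    have h' : π.symm a ⊔ π.symm b = x i := by
      rw [← map_sup, h, OrderIso.symm_apply_apply]
    rcases gen_sup_irred hn hx i _ _ h' with h1 | h1
    · left; rw [← h1]; simp
    · right; rw [← h1]; simp
  · intro a b h
    have h' : π.symm a ⊓ π.symm b = x i := by
      rw [← map_inf, h, OrderIso.symm_apply_apply]
    rcases gen_inf_irred hn hx i _ _ h' with h1 | h1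
    · left; rw [← h1]; simp
    · right; rw [← h1]; simp

theorem le_sElem (hn : 3 ≤ n) (x : Fin n → F) (i : Fin n) :
    (Finset.univ.erase i).inf' (erase_ne hn i) x ≤ sElem hn x :=
  Finset.le_sup' (fun i => (Finset.univ.erase i).inf' (erase_ne hn i) x) (Finset.mem_univ i)

theorem sElem_le (hn : 3 ≤ n) {x : Fin n → F} {t : F}
    (h : ∀ i, (Finset.univ.erase i).inf' (erase_ne hn i) x ≤ t) : sElem hn x ≤ t :=
  Finset.sup'_le _ _ fun i _ => h i

theorem symm_le (hn : 3 ≤ n) (hx : IsFreelyGenerated x) (π : F ≃o F) :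
    π (sElem hn x) ≤ sElem hn x := by
  choose σ hσ using auto_perm hn hx π
  have hinj : Function.Injective σ := by
    intro i j hij
    apply gen_inj hx
    apply π.injective
    rw [hσ, hσ, hij]
  have hsurj := Finite.surjective_of_injective hinj
  rw [← OrderIso.le_symm_apply]
  refine sElem_le hn fun i => ?_
  rw [OrderIso.le_symm_apply]
  refine le_trans ?_ (le_sElem hn x (σ i))
  rw [map_finset_inf']
  refine Finset.le_inf' _ _ fun k hk => ?_
  obtain ⟨j, rfl⟩ := hsurj k
  have hj : j ∈ Finset.univ.erase i := by
    refine Finset.mem_erase.2 ⟨?_, Finset.mem_univ _⟩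
    rintro rfl
    simp at hk
  refine (Finset.inf'_le _ hj).trans ?_
  simp [hσ]

theorem s_symm (hn : 3 ≤ n) (hx : IsFreelyGenerated x) : IsSymmElem (sElem hn x) := by
  intro π
  refine le_antisymm (symm_le hn hx π) ?_
  have := symm_le hn hx π.symm
  rwa [OrderIso.symm_apply_le] at this

theorem infGen_le (hn : 3 ≤ n) (x : Fin n → F) (i : Fin n) : infGen hn x ≤ x i :=
  Finset.inf'_le x (Finset.mem_univ i)

theorem inf_lt_s (hn : 3 ≤ n) (hx : IsFreelyGenerated x) : infGen hn x < sElem hn x := by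
  let i : Fin n := ⟨0, by omega⟩
  have h1 : infGen hn x ≤ (Finset.univ.erase i).inf' (erase_ne hn i) x :=
    Finset.le_inf' _ _ fun j _ => infGen_le hn x j
  refine lt_of_le_not_ge (h1.trans (le_sElem hn x i)) fun h => ?_
  refine not_inf_le_sup hx (Finset.univ.erase i) {i} (erase_ne hn i)
    (Finset.singleton_nonempty i) (by simp) ?_
  rw [Finset.sup'_singleton]
  exact (le_sElem hn x i).trans (h.trans (infGen_le hn x i))

theorem s_le (hn : 3 ≤ n) (hx : IsFreelyGenerated x) (t : F) (ht : IsSymmElem t)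
    (hne : t ≠ infGen hn x) : sElem hn x ≤ t := by
  have key := fun i => dichotomy hx.1 (Finset.univ.erase i) {i} (erase_ne hn i)
    (Finset.singleton_nonempty i) (by intro j; by_cases hj : j = i <;> simp [hj]) t
  by_cases hex : ∃ i, (Finset.univ.erase i).inf' (erase_ne hn i) x ≤ t
  · obtain ⟨i, hi⟩ := hex
    refine sElem_le hn fun k => ?_
    obtain ⟨π, hπ⟩ := exists_auto hx (Equiv.swap i k)
    have h1 := π.monotone hi
    rw [ht π, map_finset_inf'] at h1
    refine le_trans (Finset.le_inf' _ _ fun j hj => ?_) h1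
    simp only [Function.comp, hπ]
    apply Finset.inf'_le
    refine Finset.mem_erase.2 ⟨fun h => ?_, Finset.mem_univ _⟩
    have : j = i := by
      apply (Equiv.swap i k).injective
      rw [h, Equiv.swap_apply_left]
    simp [this] at hj
  · push Not at hex
    refine absurd (le_antisymm ?_ ?_) hne
    · refine Finset.le_inf' _ _ fun i _ => ?_
      have := (key i).resolve_left (hex i)
      simpa using this
    · exact gen_induction hx.1 (fun t => infGen hn x ≤ t) (infGen_le hn x)
        (fun a b ha _ => ha.trans le_sup_left) (fun a b ha hb => le_inf ha hb) t

theorem dBar_inf (hn : 3 ≤ n) (δ : F ≃o Fᵒᵈ) (hδ : ∀ i, dBar δ (x i) = x i) :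
    dBar δ (infGen hn x) = supGen hn x := by
  have hδ' : ∀ i, δ (x i) = OrderDual.toDual (x i) := hδ
  apply le_antisymm
  · have h : OrderDual.toDual (supGen hn x) ≤ δ (infGen hn x) := by
      rw [← OrderIso.symm_apply_le]
      refine Finset.le_inf' _ _ fun i hi => ?_
      rw [OrderIso.symm_apply_le, hδ', OrderDual.toDual_le_toDual]
      exact Finset.le_sup' x hi
    exact h
  · refine Finset.sup'_le _ _ fun i _ => ?_
    have h : δ (infGen hn x) ≤ δ (x i) := δ.monotone (infGen_le hn x i)
    rw [hδ'] at h
    exact h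

theorem le_sBar (hn : 3 ≤ n) (hx : IsFreelyGenerated x) (δ : F ≃o Fᵒᵈ)
    (hδ : ∀ i, dBar δ (x i) = x i) (t : F) (ht : IsSymmElem t)
    (hne : t ≠ supGen hn x) : t ≤ dBar δ (sElem hn x) := by
  have hu : IsSymmElem (δ.symm (OrderDual.toDual t)) := by
    intro π
    let ρ : F ≃o F := ((δ.symm.trans π).trans δ).dual
    have h : δ (π (δ.symm (OrderDual.toDual t))) = OrderDual.toDual t := ht ρ
    apply δ.injective
    rw [h, OrderIso.apply_symm_apply]
  have h1 := s_le hn hx _ hu (by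
    intro h
    apply hne
    rw [← dBar_inf hn δ hδ, ← h]
    simp [dBar])
  rw [OrderIso.le_symm_apply] at h1
  exact h1

end UA

theorem unique_atom_of_symmetric_part {n : ℕ} (hn : 3 ≤ n)
    {F : Type*} [Lattice F] (x : Fin n → F) (hx : IsFreelyGenerated x)
    (δ : F ≃o Fᵒᵈ) (hδ : ∀ i, dBar δ (x i) = x i) :
    IsSymmElem (sElem hn x) ∧ infGen hn x < sElem hn x ∧
    (∀ t : F, IsSymmElem t → t ≠ infGen hn x → t ≠ supGen hn x →
      sElem hn x ≤ t ∧ t ≤ dBar δ (sElem hn x)) ∧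
    (∀ t : F, IsSymmElem t → infGen hn x < t → sElem hn x ≤ t) ∧
    (∀ t : F, IsSymmElem t → t < supGen hn x → t ≤ dBar δ (sElem hn x)) := by
  refine ⟨UA.s_symm hn hx, UA.inf_lt_s hn hx, ?_, ?_, ?_⟩
  · intro t ht h1 h2
    exact ⟨UA.s_le hn hx t ht h1, UA.le_sBar hn hx δ hδ t ht h2⟩
  · intro t ht h
    exact UA.s_le hn hx t ht h.ne'
  · intro t ht h
    exact UA.le_sBar hn hx δ hδ t ht h.ne
end

section
/- For every i : Fin n, the sequence j ↦ p i j is strictly increasing in F: p i 0 < p i 1 < p i 2 < … , i.e. p i j < p i (j+1) for all j ∈ ℕ. -/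
open Cardinal

universe u

section FreePAux

theorem fpAux_countable {F : Type*} [Lattice F] {n : ℕ} (x : Fin n → F)
    (h : latticeClosure (Set.range x) = Set.univ) : Countable F := by
  let S : ℕ → Set F := fun k => Nat.rec (Set.range x)
    (fun _ T => T ∪ (Set.image2 (· ⊔ ·) T T ∪ Set.image2 (· ⊓ ·) T T)) k
  have hS : ∀ k, S (k + 1) = S k ∪ (Set.image2 (· ⊔ ·) (S k) (S k) ∪
      Set.image2 (· ⊓ ·) (S k) (S k)) := fun k => rfl
  have hmono : Monotone S := monotone_nat_of_le_succ fun k => by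
    rw [hS]; exact Set.subset_union_left
  have hc : ∀ k, (S k).Countable := by
    intro k
    induction k with
    | zero => exact Set.countable_range x
    | succ k ih =>
      rw [hS]
      exact ih.union ((ih.image2 ih _).union (ih.image2 ih _))
  have hsub : IsSublattice (⋃ k, S k) := by
    constructor
    · intro a ha b hb
      obtain ⟨k, hk⟩ := Set.mem_iUnion.1 ha
      obtain ⟨l, hl⟩ := Set.mem_iUnion.1 hb
      refine Set.mem_iUnion.2 ⟨max k l + 1, ?_⟩
      rw [hS]
      exact Or.inr (Or.inl ⟨a, hmono (le_max_left k l) hk, b, hmono (le_max_right k l) hl, rfl⟩)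
    · intro a ha b hb
      obtain ⟨k, hk⟩ := Set.mem_iUnion.1 ha
      obtain ⟨l, hl⟩ := Set.mem_iUnion.1 hb
      refine Set.mem_iUnion.2 ⟨max k l + 1, ?_⟩
      rw [hS]
      exact Or.inr (Or.inr ⟨a, hmono (le_max_left k l) hk, b, hmono (le_max_right k l) hl, rfl⟩)
  have h1 : latticeClosure (Set.range x) ⊆ ⋃ k, S k :=
    latticeClosure_min (Set.subset_iUnion S 0) hsub
  rw [h] at h1
  exact Set.countable_univ_iff.1 ((Set.countable_iUnion hc).mono h1)

universe fu fv fw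

/-- The extension property holds for countable lattices in every universe. -/
theorem fpAux_lift {F : Type fu} [Lattice F] {n : ℕ} {x : Fin n → F}
    (hx : IsFreelyGenerated.{fu, 0, fw} x) (K : Type fv) [Lattice K] [Countable K]
    (f : Fin n → K) : ∃ φ : LatticeHom F K, ∀ i, φ (x i) = f i := by
  have hsm : Small.{fw} K := Countable.toSmall K
  let e : K ≃ Shrink.{fw} K := equivShrink.{fw} K
  let : Max (Shrink.{fw} K) := ⟨fun a b => e (e.symm a ⊔ e.symm b)⟩
  let : Min (Shrink.{fw} K) := ⟨fun a b => e (e.symm a ⊓ e.symm b)⟩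
  let : LE (Shrink.{fw} K) := ⟨fun a b => e.symm a ≤ e.symm b⟩
  let : LT (Shrink.{fw} K) := ⟨fun a b => e.symm a < e.symm b⟩
  let : Lattice (Shrink.{fw} K) := e.symm.injective.lattice _ Iff.rfl Iff.rfl
    (fun _ _ => e.symm_apply_apply _) (fun _ _ => e.symm_apply_apply _)
  have hsup : ∀ a b : Shrink.{fw} K, e.symm (a ⊔ b) = e.symm a ⊔ e.symm b := fun a b =>
    e.symm_apply_apply _
  have hinf : ∀ a b : Shrink.{fw} K, e.symm (a ⊓ b) = e.symm a ⊓ e.symm b := fun a b =>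
    e.symm_apply_apply _
  obtain ⟨φ, hφ⟩ := hx.2 (Shrink.{fw} K) (fun i => e (f i))
  refine ⟨⟨⟨fun y => e.symm (φ y), fun a b => ?_⟩, fun a b => ?_⟩, fun i => ?_⟩
  · rw [map_sup, hsup]
  · change e.symm (φ (a ⊓ b)) = _
    rw [map_inf, hinf]
  · change e.symm (φ (x i)) = _
    rw [hφ, e.symm_apply_apply]

/-- Alan Day's doubling of the interval `[u, v]`. -/
def FpDouble {F : Type fu} [Lattice F] (u v : F) : Type fu :=
  {p : F × Prop // (p.2 → u ≤ p.1) ∧ (¬ p.2 → u ≤ p.1 → p.1 ≤ v)}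

instance {F : Type fu} [Lattice F] (u v : F) : PartialOrder (FpDouble u v) :=
  inferInstanceAs (PartialOrder {p : F × Prop // (p.2 → u ≤ p.1) ∧ (¬ p.2 → u ≤ p.1 → p.1 ≤ v)})

theorem FpDouble.le_iff {F : Type fu} [Lattice F] {u v : F} (p q : FpDouble u v) :
    p ≤ q ↔ p.1.1 ≤ q.1.1 ∧ (p.1.2 → q.1.2) := Iff.rfl

instance {F : Type fu} [Lattice F] (u v : F) : Lattice (FpDouble u v) where
  inf p q := ⟨(p.1.1 ⊓ q.1.1, p.1.2 ∧ q.1.2), fun h => le_inf (p.2.1 h.1) (q.2.1 h.2), by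
    intro h hu
    by_cases hp : p.1.2
    · have hq : ¬ q.1.2 := fun hq => h ⟨hp, hq⟩
      exact inf_le_right.trans (q.2.2 hq (hu.trans inf_le_right))
    · exact inf_le_left.trans (p.2.2 hp (hu.trans inf_le_left))⟩
  sup p q := ⟨(p.1.1 ⊔ q.1.1, p.1.2 ∨ q.1.2 ∨ (u ≤ p.1.1 ⊔ q.1.1 ∧ ¬ p.1.1 ⊔ q.1.1 ≤ v)), by
    rintro (h | h | h)
    · exact (p.2.1 h).trans le_sup_left
    · exact (q.2.1 h).trans le_sup_right
    · exact h.1, by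
    intro h hu
    by_contra hv
    exact h (Or.inr (Or.inr ⟨hu, hv⟩))⟩
  le_sup_left p q := ⟨le_sup_left, fun h => Or.inl h⟩
  le_sup_right p q := ⟨le_sup_right, fun h => Or.inr (Or.inl h)⟩
  sup_le p q r hp hq := by
    have hpq : p.1.1 ⊔ q.1.1 ≤ r.1.1 := sup_le hp.1 hq.1
    refine ⟨hpq, ?_⟩
    rintro (h | h | h)
    · exact hp.2 h
    · exact hq.2 h
    · by_contra hr
      exact h.2 (hpq.trans (r.2.2 hr (h.1.trans hpq)))
  inf_le_left p q := ⟨inf_le_left, fun h => h.1⟩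
  inf_le_right p q := ⟨inf_le_right, fun h => h.2⟩
  le_inf p q r hq hr := ⟨le_inf hq.1 hr.1, fun h => ⟨hq.2 h, hr.2 h⟩⟩

/-- Whitman's condition. -/
theorem fpAux_whitman {F : Type fu} [Lattice F] {n : ℕ} {x : Fin n → F}
    (hx : IsFreelyGenerated.{fu, 0, fw} x) {a b c d : F} (h : a ⊓ b ≤ c ⊔ d) :
    a ≤ c ⊔ d ∨ b ≤ c ⊔ d ∨ a ⊓ b ≤ c ∨ a ⊓ b ≤ d := by
  by_contra! hcon
  obtain ⟨ha, hb, hc, hd⟩ := hcon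
  have : Countable F := fpAux_countable x hx.1
  have : Countable Prop := Finite.to_countable
  have : Countable (FpDouble (a ⊓ b) (c ⊔ d)) :=
    inferInstanceAs (Countable {p : F × Prop // _})
  obtain ⟨φ, hφ⟩ := fpAux_lift hx (FpDouble (a ⊓ b) (c ⊔ d)) (fun i =>
    ⟨(x i, a ⊓ b ≤ x i), fun h => h, fun h h' => absurd h' h⟩)
  have hsec : ∀ y, (φ y).1.1 = y := by
    have hsub : IsSublattice {y | (φ y).1.1 = y} := by
      constructor
      · intro y hy z hz
        change (φ (y ⊔ z)).1.1 = y ⊔ z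
        rw [map_sup]
        exact congrArg₂ (· ⊔ ·) hy hz
      · intro y hy z hz
        change (φ (y ⊓ z)).1.1 = y ⊓ z
        rw [map_inf]
        exact congrArg₂ (· ⊓ ·) hy hz
    have h1 := latticeClosure_min (s := Set.range x) (t := {y | (φ y).1.1 = y}) (by
      rintro _ ⟨i, rfl⟩
      change (φ (x i)).1.1 = x i
      rw [hφ]) hsub
    rw [hx.1] at h1
    exact fun y => h1 (Set.mem_univ y)
  have ha' : (φ a).1.2 := by
    by_contra hn
    have := (φ a).2.2 hn
    rw [hsec] at this
    exact ha (this inf_le_left)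
  have hb' : (φ b).1.2 := by
    by_contra hn
    have := (φ b).2.2 hn
    rw [hsec] at this
    exact hb (this inf_le_right)
  have hc' : ¬ (φ c).1.2 := by
    intro hn
    have := (φ c).2.1 hn
    rw [hsec] at this
    exact hc this
  have hd' : ¬ (φ d).1.2 := by
    intro hn
    have := (φ d).2.1 hn
    rw [hsec] at this
    exact hd this
  have hle : φ (a ⊓ b) ≤ φ (c ⊔ d) := OrderHomClass.mono φ h
  rw [map_inf, map_sup] at hle
  have h2 : (φ c).1.2 ∨ (φ d).1.2 ∨ (a ⊓ b ≤ (φ c).1.1 ⊔ (φ d).1.1 ∧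
      ¬ (φ c).1.1 ⊔ (φ d).1.1 ≤ c ⊔ d) := hle.2 ⟨ha', hb'⟩
  rw [hsec, hsec] at h2
  rcases h2 with h2 | h2 | h2
  · exact hc' h2
  · exact hd' h2
  · exact h2.2 le_rfl

theorem fpAux_fold_le {F α : Type*} [Lattice F] (s : Finset α) (g : α → F) (y w : F) :
    s.fold (fun c d : F => c ⊔ d) y g ≤ w ↔ y ≤ w ∧ ∀ q ∈ s, g q ≤ w := by
  classical
  induction s using Finset.induction_on with
  | empty => simp
  | insert q s hq ih =>
    rw [Finset.fold_insert hq, sup_le_iff, ih]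
    simp only [Finset.mem_insert, forall_eq_or_imp]
    tauto

theorem fpAux_whitman_fold {F : Type fu} [Lattice F] {n : ℕ} {x : Fin n → F}
    (hx : IsFreelyGenerated.{fu, 0, fw} x) {a b : F} {α : Type*} (s : Finset α) (g : α → F)
    (y : F) (h : a ⊓ b ≤ s.fold (fun c d : F => c ⊔ d) y g) :
    a ≤ s.fold (fun c d : F => c ⊔ d) y g ∨ b ≤ s.fold (fun c d : F => c ⊔ d) y g ∨ a ⊓ b ≤ y ∨ ∃ q ∈ s, a ⊓ b ≤ g q := by
  classical
  induction s using Finset.induction_on with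
  | empty => exact Or.inr (Or.inr (Or.inl (by simpa using h)))
  | insert q s hq ih =>
    rw [Finset.fold_insert hq] at h ⊢
    rcases fpAux_whitman hx h with h | h | h | h
    · exact Or.inl h
    · exact Or.inr (Or.inl h)
    · exact Or.inr (Or.inr (Or.inr ⟨q, Finset.mem_insert_self _ _, h⟩))
    · rcases ih h with h | h | h | ⟨r, hr, h⟩
      · exact Or.inl (h.trans le_sup_right)
      · exact Or.inr (Or.inl (h.trans le_sup_right))
      · exact Or.inr (Or.inr (Or.inl h))
      · exact Or.inr (Or.inr (Or.inr ⟨r, Finset.mem_insert_of_mem hr, h⟩))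

variable {n : ℕ} {F : Type fu} [Lattice F] {x : Fin n → F}

theorem fpAux_succ_le (x : Fin n → F) (j : ℕ) (i : Fin n) (w : F) :
    freeP x (j + 1) i ≤ w ↔ x i ≤ w ∧
      ∀ a b, a ≠ b → a ≠ i → b ≠ i → freeP x j a ⊓ freeP x j b ≤ w := by
  rw [freeP, fpAux_fold_le]
  simp [Prod.forall]

theorem fpAux_gen_le (x : Fin n → F) (j : ℕ) (i : Fin n) : x i ≤ freeP x j i := by
  cases j with
  | zero => exact le_rfl
  | succ j => exact ((fpAux_succ_le x j i _).1 le_rfl).1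

theorem fpAux_pair_le (x : Fin n → F) (j : ℕ) {i a b : Fin n} (hab : a ≠ b) (ha : a ≠ i)
    (hb : b ≠ i) : freeP x j a ⊓ freeP x j b ≤ freeP x (j + 1) i :=
  ((fpAux_succ_le x j i _).1 le_rfl).2 a b hab ha hb

theorem fpAux_step (x : Fin n → F) (j : ℕ) : ∀ i, freeP x j i ≤ freeP x (j + 1) i := by
  induction j with
  | zero => exact fun i => fpAux_gen_le x 1 i
  | succ j ih =>
    intro i
    rw [fpAux_succ_le]
    exact ⟨fpAux_gen_le x _ i, fun a b hab ha hb =>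
      (inf_le_inf (ih a) (ih b)).trans (fpAux_pair_le x (j + 1) hab ha hb)⟩

theorem fpAux_mono (x : Fin n → F) (i : Fin n) : Monotone fun j => freeP x j i :=
  monotone_nat_of_le_succ fun j => fpAux_step x j i

theorem fpAux_two (hn : 3 ≤ n) (i : Fin n) : ∃ a b : Fin n, a ≠ b ∧ a ≠ i ∧ b ≠ i := by
  have h : 1 < ((Finset.univ : Finset (Fin n)).erase i).card := by
    rw [Finset.card_erase_of_mem (Finset.mem_univ _), Finset.card_univ, Fintype.card_fin]
    omega
  obtain ⟨a, ha, b, hb, hab⟩ := Finset.one_lt_card.1 h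
  exact ⟨a, b, hab, Finset.ne_of_mem_erase ha, Finset.ne_of_mem_erase hb⟩

theorem fpAux_map {K : Type fv} [Lattice K] (φ : LatticeHom F K) (x : Fin n → F) (j : ℕ) :
    ∀ i, φ (freeP x j i) = freeP (fun i => φ (x i)) j i := by
  induction j with
  | zero => exact fun i => rfl
  | succ j ih =>
    intro i
    rw [freeP, freeP, ← Finset.fold_hom (op := fun c d : F => c ⊔ d) (op' := fun c d : K => c ⊔ d) (m := φ) (fun a b => map_sup φ a b)]
    simp only [map_inf, ih]

/-- A generator is not below `p c k` for another index `c`. -/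
theorem fpAux_A (hx : IsFreelyGenerated.{fu, 0, fw} x) {a c : Fin n} (hac : a ≠ c) (k : ℕ) :
    ¬ x a ≤ freeP x k c := by
  intro h
  obtain ⟨φ, hφ⟩ := fpAux_lift hx Bool (fun i => decide (i = a))
  have key : ∀ k c, c ≠ a → freeP (fun i => φ (x i)) k c ≤ (⊥ : Bool) := by
    intro k
    induction k with
    | zero =>
      intro c hc
      change φ (x c) ≤ ⊥
      rw [hφ]
      simp [hc]
    | succ k ih =>
      intro c hc
      rw [fpAux_succ_le]
      refine ⟨by rw [hφ]; simp [hc], fun d e hde _ _ => ?_⟩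
      by_cases hd : d = a
      · exact inf_le_right.trans (ih e (fun he => hde (hd.trans he.symm)))
      · exact inf_le_left.trans (ih d hd)
  have h1 : φ (x a) ≤ φ (freeP x k c) := OrderHomClass.mono φ h
  rw [fpAux_map] at h1
  have h2 := h1.trans (key k c hac.symm)
  rw [hφ] at h2
  exact absurd h2 (by simp)

theorem fpAux_B (hn : 3 ≤ n) (hx : IsFreelyGenerated.{fu, 0, fw} x) {a b c : Fin n} (j : ℕ)
    (ha : a ≠ c ∨ 1 ≤ j) (hb : b ≠ c ∨ 1 ≤ j) :
    ¬ freeP x j a ⊓ freeP x j b ≤ x c := by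
  intro h
  obtain ⟨φ, hφ⟩ := fpAux_lift hx Bool (fun i => decide (i ≠ c))
  have key0 : ∀ k a, a ≠ c → (⊤ : Bool) ≤ φ (freeP x k a) := by
    intro k a ha
    have h1 : φ (x a) ≤ φ (freeP x k a) := OrderHomClass.mono φ (fpAux_gen_le x k a)
    rw [hφ] at h1
    simpa [ha] using h1
  have key : ∀ a, (a ≠ c ∨ 1 ≤ j) → (⊤ : Bool) ≤ φ (freeP x j a) := by
    intro a ha
    by_cases hac : a = c
    · obtain ⟨k, rfl⟩ : ∃ k, j = k + 1 := ⟨j - 1, by have := ha.resolve_left (by simpa); omega⟩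
      obtain ⟨d, e, hde, hd, he⟩ := fpAux_two hn c
      subst hac
      have h1 : φ (freeP x k d ⊓ freeP x k e) ≤ φ (freeP x (k + 1) a) :=
        OrderHomClass.mono φ (fpAux_pair_le x k hde hd he)
      rw [map_inf] at h1
      exact (le_inf (key0 k d hd) (key0 k e he)).trans h1
    · exact key0 j a hac
  have h1 : φ (freeP x j a ⊓ freeP x j b) ≤ φ (x c) := OrderHomClass.mono φ h
  rw [map_inf] at h1
  have h2 := (le_inf (key a ha) (key b hb)).trans h1
  rw [hφ] at h2
  exact absurd h2 (by simp)

/-- Whitman's condition for `p`. -/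
theorem fpAux_W (hx : IsFreelyGenerated.{fu, 0, fw} x) {a b : F} {k : ℕ} {c : Fin n}
    (h : a ⊓ b ≤ freeP x (k + 1) c) :
    a ≤ freeP x (k + 1) c ∨ b ≤ freeP x (k + 1) c ∨ a ⊓ b ≤ x c ∨
      ∃ d, a ⊓ b ≤ freeP x k d := by
  rw [freeP] at h ⊢
  rcases fpAux_whitman_fold hx _ _ _ h with h | h | h | ⟨q, -, h⟩
  · exact Or.inl h
  · exact Or.inr (Or.inl h)
  · exact Or.inr (Or.inr (Or.inl h))
  · exact Or.inr (Or.inr (Or.inr ⟨q.1, h.trans inf_le_left⟩))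

theorem fpAux_claim (hn : 3 ≤ n) (hx : IsFreelyGenerated.{fu, 0, fw} x) (k : ℕ) :
    ∀ j, k < j → ∀ a b c : Fin n, a ≠ b → ¬ freeP x j a ⊓ freeP x j b ≤ freeP x k c := by
  induction k with
  | zero => exact fun j hj a b c _ => fpAux_B hn hx j (Or.inr hj) (Or.inr hj)
  | succ k ih =>
    intro j hj a b c hab h
    have aux : ∀ a, ¬ freeP x j a ≤ freeP x (k + 1) c := by
      intro a ha
      by_cases hac : a = c
      · subst hac
        obtain ⟨d, e, hde, hd, he⟩ := fpAux_two hn a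
        have h1 := (fpAux_pair_le x (k + 1) hde hd he).trans ((fpAux_mono x a hj).trans ha)
        rcases fpAux_W hx h1 with h | h | h | ⟨q, h⟩
        · exact fpAux_A hx hd _ ((fpAux_gen_le x _ d).trans h)
        · exact fpAux_A hx he _ ((fpAux_gen_le x _ e).trans h)
        · exact fpAux_B hn hx _ (Or.inl hd) (Or.inl he) h
        · exact ih (k + 1) (Nat.lt_succ_self k) d e q hde h
      · exact fpAux_A hx hac _ ((fpAux_gen_le x _ a).trans ha)
    rcases fpAux_W hx h with h | h | h | ⟨q, h⟩
    · exact aux a h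
    · exact aux b h
    · exact fpAux_B hn hx _ (Or.inr (by omega)) (Or.inr (by omega)) h
    · exact ih j (by omega) a b q hab h

end FreePAux

theorem freeP_strictMono {n : ℕ} (hn : 3 ≤ n)
    {F : Type*} [Lattice F] (x : Fin n → F) (hx : IsFreelyGenerated x) :
    ∀ (i : Fin n) (j : ℕ), freeP x j i < freeP x (j + 1) i := by
  intro i j
  refine lt_of_le_not_ge (fpAux_step x j i) fun hle => ?_
  obtain ⟨d, e, hde, hd, he⟩ := fpAux_two hn i
  have h1 := (fpAux_pair_le x j hde hd he).trans hle
  cases j with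
  | zero => exact fpAux_B hn hx 0 (Or.inl hd) (Or.inl he) h1
  | succ k =>
    rcases fpAux_W hx h1 with h | h | h | ⟨q, h⟩
    · exact fpAux_A hx hd _ ((fpAux_gen_le x _ d).trans h)
    · exact fpAux_A hx he _ ((fpAux_gen_le x _ e).trans h)
    · exact fpAux_B hn hx _ (Or.inl hd) (Or.inl he) h
    · exact fpAux_claim hn hx k (k + 1) (Nat.lt_succ_self k) d e q hde h
end

section
/- For every j ∈ ℕ, the elements m j and (m j)̄ are doubly prime in the lattice of symmetric elements of F: for all symmetric elements h₁, h₂ of F, (m j ≤ h₁ ⊔ h₂ implies m j ≤ h₁ or m j ≤ h₂) and (h₁ ⊓ h₂ ≤ m j implies h₁ ≤ m j or h₂ ≤ m j), and the same two implications hold with m j replaced by (m j)̄. -/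
open Cardinal

universe u

namespace FreeMAux

/-- Lattice terms. -/
inductive Term (n : ℕ) : Type
  | var : Fin n → Term n
  | sup : Term n → Term n → Term n
  | inf : Term n → Term n → Term n

def Term.eval {n : ℕ} {F : Type*} [Lattice F] (x : Fin n → F) : Term n → F
  | .var i => x i
  | .sup a b => a.eval x ⊔ b.eval x
  | .inf a b => a.eval x ⊓ b.eval x

theorem closure_ind {n : ℕ} {F : Type*} [Lattice F] {x : Fin n → F}
    (hx : latticeClosure (Set.range x) = Set.univ) (P : F → Prop) (h0 : ∀ i, P (x i))
    (hs : ∀ a b, P a → P b → P (a ⊔ b)) (hi : ∀ a b, P a → P b → P (a ⊓ b)) (y : F) : P y := by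
  have h : latticeClosure (Set.range x) ⊆ {y | P y} := by
    apply latticeClosure_min
    · rintro _ ⟨i, rfl⟩
      exact h0 i
    · exact ⟨fun a ha b hb => hs a b ha hb, fun a ha b hb => hi a b ha hb⟩
  rw [hx] at h
  exact h (Set.mem_univ y)

universe w v'

theorem small_F {n : ℕ} {F : Type*} [Lattice F] {x : Fin n → F}
    (hx : latticeClosure (Set.range x) = Set.univ) : Small.{w} F := by
  have hs : Function.Surjective (Term.eval x) := by
    apply closure_ind hx
    · intro i
      exact ⟨.var i, rfl⟩
    · rintro _ _ ⟨a, rfl⟩ ⟨b, rfl⟩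
      exact ⟨.sup a b, rfl⟩
    · rintro _ _ ⟨a, rfl⟩ ⟨b, rfl⟩
      exact ⟨.inf a b, rfl⟩
  exact small_of_surjective hs

theorem ext_small {n : ℕ} {F : Type*} [Lattice F] {x : Fin n → F}
    (hx : IsFreelyGenerated.{_, _, w} x) (K : Type v') [Lattice K] [Small.{w} K] (f : Fin n → K) :
    ∃ φ : F → K, (∀ a b, φ (a ⊔ b) = φ a ⊔ φ b) ∧ (∀ a b, φ (a ⊓ b) = φ a ⊓ φ b) ∧
      ∀ i, φ (x i) = f i := by
  let e := equivShrink.{w} K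
  letI : Lattice (Shrink.{w} K) :=
    { le := fun a b => e.symm a ≤ e.symm b
      lt := fun a b => e.symm a < e.symm b
      le_refl := fun a => le_refl (e.symm a)
      le_trans := fun a b c h1 h2 => le_trans (α := K) h1 h2
      lt_iff_le_not_ge := fun a b => lt_iff_le_not_ge (α := K)
      le_antisymm := fun a b h1 h2 => e.symm.injective (le_antisymm (α := K) h1 h2)
      sup := fun a b => e (e.symm a ⊔ e.symm b)
      inf := fun a b => e (e.symm a ⊓ e.symm b)
      le_sup_left := fun a b => by simp
      le_sup_right := fun a b => by simp
      sup_le := fun a b c h1 h2 => by simpa using ⟨h1, h2⟩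
      inf_le_left := fun a b => by simp
      inf_le_right := fun a b => by simp
      le_inf := fun a b c h1 h2 => by simpa using ⟨h1, h2⟩ }
  obtain ⟨φ, hφ⟩ := hx.2 (Shrink.{w} K) (fun i => e (f i))
  refine ⟨fun a => e.symm (φ a), fun a b => ?_, fun a b => ?_, fun i => ?_⟩
  · change e.symm (φ (a ⊔ b)) = _
    rw [map_sup]
    exact e.symm_apply_apply _
  · change e.symm (φ (a ⊓ b)) = _
    rw [map_inf]
    exact e.symm_apply_apply _
  · simp [hφ]

/-- Day's doubling of the interval `[u, v]`. -/
def Dbl {F : Type*} [Lattice F] (u v : F) : Type _ :=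
  {p : F × Prop // (p.2 → u ≤ p.1) ∧ (¬ p.2 → p.1 ≤ v ∨ ¬ u ≤ p.1)}

def dblLattice {F : Type*} [Lattice F] (u v : F) : Lattice (Dbl u v) :=
  { le := fun a b => a.1.1 ≤ b.1.1 ∧ (a.1.2 → b.1.2)
    le_refl := fun a => ⟨le_rfl, id⟩
    le_trans := fun a b c h1 h2 => ⟨h1.1.trans h2.1, fun h => h2.2 (h1.2 h)⟩
    le_antisymm := fun a b h1 h2 =>
      Subtype.ext (Prod.ext (le_antisymm h1.1 h2.1) (propext ⟨h1.2, h2.2⟩))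
    sup := fun a b => ⟨(a.1.1 ⊔ b.1.1,
        a.1.2 ∨ b.1.2 ∨ (u ≤ a.1.1 ⊔ b.1.1 ∧ ¬ a.1.1 ⊔ b.1.1 ≤ v)), by
      constructor
      · rintro (h | h | h)
        · exact le_sup_of_le_left (a.2.1 h)
        · exact le_sup_of_le_right (b.2.1 h)
        · exact h.1
      · intro h
        dsimp only at *
        tauto⟩
    inf := fun a b => ⟨(a.1.1 ⊓ b.1.1, a.1.2 ∧ b.1.2), by
      constructor
      · rintro ⟨h1, h2⟩
        exact le_inf (a.2.1 h1) (b.2.1 h2)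
      · intro h
        have ha := a.2.2
        have hb := b.2.2
        dsimp only at *
        rw [le_inf_iff]
        have h3 : a.1.1 ≤ v → a.1.1 ⊓ b.1.1 ≤ v := fun h => inf_le_of_left_le h
        have h4 : b.1.1 ≤ v → a.1.1 ⊓ b.1.1 ≤ v := fun h => inf_le_of_right_le h
        tauto⟩
    le_sup_left := fun a b => ⟨le_sup_left, Or.inl⟩
    le_sup_right := fun a b => ⟨le_sup_right, fun h => Or.inr (Or.inl h)⟩
    sup_le := fun a b c h1 h2 => ⟨sup_le h1.1 h2.1, by
      rintro (h | h | h)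
      · exact h1.2 h
      · exact h2.2 h
      · by_contra hc
        have h3 : a.1.1 ⊔ b.1.1 ≤ c.1.1 := sup_le h1.1 h2.1
        rcases c.2.2 hc with h4 | h4
        · exact h.2 (h3.trans h4)
        · exact h4 (h.1.trans h3)⟩
    inf_le_left := fun a b => ⟨inf_le_left, And.left⟩
    inf_le_right := fun a b => ⟨inf_le_right, And.right⟩
    le_inf := fun a b c h1 h2 => ⟨le_inf h1.1 h2.1, fun h => ⟨h1.2 h, h2.2 h⟩⟩ }

section
variable {n : ℕ} {F : Type*} [Lattice F] {x : Fin n → F}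

theorem doubling (hx : IsFreelyGenerated.{_, _, w} x) (u v : F) (s : Prop) :
    ∃ g : F → Prop, (∀ y, g y → u ≤ y) ∧ (∀ y, ¬ g y → y ≤ v ∨ ¬ u ≤ y) ∧
      (∀ y z, g (y ⊓ z) ↔ g y ∧ g z) ∧
      (∀ y z, g (y ⊔ z) ↔ g y ∨ g z ∨ (u ≤ y ⊔ z ∧ ¬ y ⊔ z ≤ v)) ∧
      (∀ i, u ≤ x i → x i ≤ v → (g (x i) ↔ s)) := by
  classical
  letI := dblLattice u v
  haveI : Small.{w} F := small_F hx.1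
  haveI : Small.{w} (Dbl u v) := by unfold Dbl; infer_instance
  obtain ⟨φ, h1, h2, h3⟩ := ext_small hx (Dbl u v)
    (fun i => ⟨(x i, u ≤ x i ∧ (x i ≤ v → s)), fun h => h.1, fun h => by
      dsimp only at *
      tauto⟩)
  have hid : ∀ y, (φ y).1.1 = y := by
    apply closure_ind hx.1
    · intro i
      rw [h3]
    · intro a b ha hb
      rw [h1]
      change (φ a).1.1 ⊔ (φ b).1.1 = _
      rw [ha, hb]
    · intro a b ha hb
      rw [h2]
      change (φ a).1.1 ⊓ (φ b).1.1 = _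
      rw [ha, hb]
  refine ⟨fun y => (φ y).1.2, fun y h => ?_, fun y h => ?_, fun y z => ?_, fun y z => ?_,
    fun i hi hi' => ?_⟩
  · have := (φ y).2.1 h
    rwa [hid] at this
  · have := (φ y).2.2 h
    rwa [hid] at this
  · dsimp only
    rw [h2]
    exact Iff.rfl
  · dsimp only
    rw [h1]
    change _ ∨ _ ∨ (u ≤ (φ y).1.1 ⊔ (φ z).1.1 ∧ ¬ (φ y).1.1 ⊔ (φ z).1.1 ≤ v) ↔ _
    rw [hid, hid]
  · dsimp only
    rw [h3]
    dsimp only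
    tauto

theorem whitman (hx : IsFreelyGenerated.{_, _, w} x) {a b c d : F} (h : a ⊓ b ≤ c ⊔ d) :
    a ≤ c ⊔ d ∨ b ≤ c ⊔ d ∨ a ⊓ b ≤ c ∨ a ⊓ b ≤ d := by
  by_contra! hc
  obtain ⟨ha, hb, hc, hd⟩ := hc
  obtain ⟨g, g1, g2, g3, g4, -⟩ := doubling hx (a ⊓ b) (c ⊔ d) True
  have ga : g a := by
    by_contra h'
    rcases g2 _ h' with h' | h'
    · exact ha h'
    · exact h' inf_le_left
  have gb : g b := by
    by_contra h'
    rcases g2 _ h' with h' | h'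
    · exact hb h'
    · exact h' inf_le_right
  have gab : g (a ⊓ b) := (g3 _ _).2 ⟨ga, gb⟩
  rw [← inf_eq_left.2 h, g3, g4] at gab
  rcases gab.2 with h' | h' | h'
  · exact hc (g1 _ h')
  · exact hd (g1 _ h')
  · exact h'.2 le_rfl

theorem gen_join (hx : IsFreelyGenerated.{_, _, w} x) {i : Fin n} {c d : F} (h : x i ≤ c ⊔ d) :
    x i ≤ c ∨ x i ≤ d := by
  by_contra! hc
  obtain ⟨hc, hd⟩ := hc
  obtain ⟨g, g1, g2, g3, g4, g5⟩ := doubling hx (x i) (c ⊔ d) True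
  have ga : g (x i) := (g5 i le_rfl h).2 trivial
  rw [← inf_eq_left.2 h, g3, g4] at ga
  rcases ga.2 with h' | h' | h'
  · exact hc (g1 _ h')
  · exact hd (g1 _ h')
  · exact h'.2 le_rfl

theorem gen_meet (hx : IsFreelyGenerated.{_, _, w} x) {i : Fin n} {a b : F} (h : a ⊓ b ≤ x i) :
    a ≤ x i ∨ b ≤ x i := by
  by_contra! hc
  obtain ⟨ha, hb⟩ := hc
  obtain ⟨g, g1, g2, g3, g4, g5⟩ := doubling hx (a ⊓ b) (x i) False
  have ga : g a := by
    by_contra h'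
    rcases g2 _ h' with h' | h'
    · exact ha h'
    · exact h' inf_le_left
  have gb : g b := by
    by_contra h'
    rcases g2 _ h' with h' | h'
    · exact hb h'
    · exact h' inf_le_right
  have gab : g (a ⊓ b) := (g3 _ _).2 ⟨ga, gb⟩
  rw [← inf_eq_left.2 h, g3] at gab
  exact (g5 i h le_rfl).1 gab.2

theorem fold_le {α : Type*} (S : Finset α) (c z : F) (f : α → F) :
    S.fold (fun a b : F => a ⊔ b) c f ≤ z ↔ c ≤ z ∧ ∀ q ∈ S, f q ≤ z := by
  classical
  induction S using Finset.induction_on with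
  | empty => simp
  | insert a S ha ih =>
    rw [Finset.fold_insert ha, sup_le_iff, ih, Finset.forall_mem_insert]
    tauto

theorem whitman_fold (hx : IsFreelyGenerated.{_, _, w} x) {α : Type*} (S : Finset α) (a b c : F)
    (f : α → F) (h : a ⊓ b ≤ S.fold (fun a b : F => a ⊔ b) c f) :
    a ≤ S.fold (fun a b : F => a ⊔ b) c f ∨ b ≤ S.fold (fun a b : F => a ⊔ b) c f ∨ a ⊓ b ≤ c ∨ ∃ q ∈ S, a ⊓ b ≤ f q := by
  classical
  induction S using Finset.induction_on with
  | empty =>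
    rw [Finset.fold_empty] at h
    exact Or.inr (Or.inr (Or.inl h))
  | insert q S hq ih =>
    rw [Finset.fold_insert hq] at h ⊢
    rcases whitman hx h with h | h | h | h
    · exact Or.inl h
    · exact Or.inr (Or.inl h)
    · exact Or.inr (Or.inr (Or.inr ⟨q, Finset.mem_insert_self _ _, h⟩))
    · rcases ih h with h | h | h | ⟨r, hr, h⟩
      · exact Or.inl (le_sup_of_le_right h)
      · exact Or.inr (Or.inl (le_sup_of_le_right h))
      · exact Or.inr (Or.inr (Or.inl h))
      · exact Or.inr (Or.inr (Or.inr ⟨r, Finset.mem_insert_of_mem hr, h⟩))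

theorem whitman_sup (hx : IsFreelyGenerated.{_, _, w} x) {α : Type*} (S : Finset α)
    (hS : S.Nonempty) (a b : F) (f : α → F) (h : a ⊓ b ≤ S.sup' hS f) :
    a ≤ S.sup' hS f ∨ b ≤ S.sup' hS f ∨ ∃ q ∈ S, a ⊓ b ≤ f q := by
  obtain ⟨q, hq⟩ := hS
  have e : S.sup' ⟨q, hq⟩ f = S.fold (fun a b : F => a ⊔ b) (f q) f := by
    apply le_antisymm
    · exact Finset.sup'_le _ _ ((fold_le S (f q) _ f).1 le_rfl).2
    · exact (fold_le S (f q) _ f).2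
        ⟨Finset.le_sup' f hq, fun r hr => Finset.le_sup' f hr⟩
  rw [e] at h ⊢
  rcases whitman_fold hx S a b (f q) f h with h | h | h | h
  · exact Or.inl h
  · exact Or.inr (Or.inl h)
  · exact Or.inr (Or.inr ⟨q, hq, h⟩)
  · exact Or.inr (Or.inr h)

theorem perm_aut (hx : IsFreelyGenerated.{_, _, w} x) (σ : Equiv.Perm (Fin n)) :
    ∃ π : F ≃o F, ∀ i, π (x i) = x (σ i) := by
  haveI : Small.{w} F := small_F hx.1
  obtain ⟨φ, h1, h2, h3⟩ := ext_small hx F (fun i => x (σ i))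
  obtain ⟨ψ, k1, k2, k3⟩ := ext_small hx F (fun i => x (σ.symm i))
  have e1 : ∀ y, ψ (φ y) = y := by
    apply closure_ind hx.1
    · intro i
      rw [h3, k3, Equiv.symm_apply_apply]
    · intro a b ha hb
      rw [h1, k1, ha, hb]
    · intro a b ha hb
      rw [h2, k2, ha, hb]
  have e2 : ∀ y, φ (ψ y) = y := by
    apply closure_ind hx.1
    · intro i
      rw [k3, h3, Equiv.apply_symm_apply]
    · intro a b ha hb
      rw [k1, h1, ha, hb]
    · intro a b ha hb
      rw [k2, h2, ha, hb]
  refine ⟨⟨⟨φ, ψ, e1, e2⟩, ?_⟩, h3⟩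
  intro a b
  change φ a ≤ φ b ↔ a ≤ b
  rw [← inf_eq_left, ← h2, ← inf_eq_left]
  constructor
  · intro h
    rw [← e1 (a ⊓ b), h, e1]
  · intro h
    rw [h]

theorem perm_p (π : F ≃o F) (σ : Equiv.Perm (Fin n)) (h : ∀ i, π (x i) = x (σ i)) (j : ℕ) :
    ∀ i, π (freeP x j i) ≤ freeP x j (σ i) := by
  induction j with
  | zero =>
    intro i
    exact (h i).le
  | succ j ih =>
    intro i
    rw [← OrderIso.le_symm_apply]
    unfold freeP
    rw [fold_le]
    have H := (fold_le (Finset.univ.filter fun q : Fin n × Fin n =>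
      q.1 ≠ q.2 ∧ q.1 ≠ σ i ∧ q.2 ≠ σ i) (x (σ i)) _
      (fun q => freeP x j q.1 ⊓ freeP x j q.2)).1 le_rfl
    constructor
    · rw [OrderIso.le_symm_apply, h]
      exact H.1
    · rintro ⟨k, l⟩ hq
      simp only [Finset.mem_filter, Finset.mem_univ, true_and] at hq
      rw [OrderIso.le_symm_apply]
      have := H.2 (σ k, σ l) (by simpa using hq)
      refine le_trans ?_ this
      dsimp only
      rw [map_inf]
      exact inf_le_inf (ih k) (ih l)

theorem le_all_p (hx : IsFreelyGenerated.{_, _, w} x) {h : F} (hs : IsSymmElem h) {j : ℕ}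
    {i : Fin n} (hi : h ≤ freeP x j i) (k : Fin n) : h ≤ freeP x j k := by
  obtain ⟨π, hπ⟩ := perm_aut hx (Equiv.swap i k)
  have := perm_p π _ hπ j i
  rw [Equiv.swap_apply_left] at this
  rw [← hs π]
  exact (π.monotone hi).trans this

theorem inf_symm {a b : F} (ha : IsSymmElem a) (hb : IsSymmElem b) : IsSymmElem (a ⊓ b) := by
  intro π
  rw [map_inf, ha, hb]

theorem x_le_p (j : ℕ) (i : Fin n) : x i ≤ freeP x j i := by
  cases j with
  | zero => exact le_rfl
  | succ j =>
    unfold freeP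
    exact ((fold_le _ _ _ _).1 le_rfl).1

theorem exists_two (hn : 3 ≤ n) (i : Fin n) : ∃ k l : Fin n, k ≠ l ∧ k ≠ i ∧ l ≠ i := by
  have h : 1 < (Finset.univ.erase i).card := by
    rw [Finset.card_erase_of_mem (Finset.mem_univ i), Finset.card_univ, Fintype.card_fin]
    omega
  obtain ⟨k, hk, l, hl, hkl⟩ := Finset.one_lt_card.1 h
  exact ⟨k, l, hkl, Finset.ne_of_mem_erase hk, Finset.ne_of_mem_erase hl⟩

theorem p_prime (hn : 3 ≤ n) (hx : IsFreelyGenerated.{_, _, w} x) {a b : F} (ha : IsSymmElem a)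
    (hb : IsSymmElem b) (j : ℕ) : ∀ i, a ⊓ b ≤ freeP x j i →
      (∀ k, a ≤ freeP x j k) ∨ (∀ k, b ≤ freeP x j k) := by
  have h0 : ∀ i, a ⊓ b ≤ x i → (∀ k, a ≤ x k) ∨ (∀ k, b ≤ x k) := by
    intro i h
    rcases gen_meet hx h with h | h
    · exact Or.inl (le_all_p hx ha (j := 0) h)
    · exact Or.inr (le_all_p hx hb (j := 0) h)
  induction j with
  | zero => exact h0
  | succ j ih =>
    intro i h
    have step : ∀ c : F, (∀ k, c ≤ freeP x j k) → ∀ k, c ≤ freeP x (j + 1) k := by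
      intro c hc k
      obtain ⟨p, q, h1, h2, h3⟩ := exists_two hn k
      have := ((fold_le (Finset.univ.filter fun q : Fin n × Fin n =>
        q.1 ≠ q.2 ∧ q.1 ≠ k ∧ q.2 ≠ k) (x k) _
        (fun q => freeP x j q.1 ⊓ freeP x j q.2)).1 le_rfl).2 (p, q)
          (by simp [h1, h2, h3])
      unfold freeP
      exact (le_inf (hc p) (hc q)).trans this
    have h' := h
    unfold freeP at h'
    rcases whitman_fold hx _ _ _ _ _ h' with h' | h' | h' | ⟨q, -, h'⟩
    · exact Or.inl (le_all_p hx ha (j := j + 1) (i := i) (by unfold freeP; exact h'))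
    · exact Or.inr (le_all_p hx hb (j := j + 1) (i := i) (by unfold freeP; exact h'))
    · rcases h0 i h' with h' | h'
      · exact Or.inl fun k => (h' k).trans (x_le_p _ _)
      · exact Or.inr fun k => (h' k).trans (x_le_p _ _)
    · rcases ih q.1 (h'.trans inf_le_left) with h' | h'
      · exact Or.inl (step a h')
      · exact Or.inr (step b h')

theorem pair_le_m (hn : 3 ≤ n) (j : ℕ) {i k : Fin n} (h : i ≠ k) :
    freeP x j i ⊓ freeP x j k ≤ freeM hn x j := by
  unfold freeM
  exact Finset.le_sup' (fun q : Fin n × Fin n => freeP x j q.1 ⊓ freeP x j q.2)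
    (b := (i, k)) (by simpa using h)

theorem m_meet (hn : 3 ≤ n) (hx : IsFreelyGenerated.{_, _, w} x) {a b : F} (ha : IsSymmElem a)
    (hb : IsSymmElem b) (j : ℕ) (h : a ⊓ b ≤ freeM hn x j) :
    a ≤ freeM hn x j ∨ b ≤ freeM hn x j := by
  have h' := h
  unfold freeM at h'
  rcases whitman_sup hx _ _ _ _ _ h' with h' | h' | ⟨q, -, h'⟩
  · exact Or.inl h'
  · exact Or.inr h'
  · obtain ⟨k, l, hkl, -, -⟩ := exists_two hn q.1
    rcases p_prime hn hx ha hb j q.1 (h'.trans inf_le_left) with h' | h'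
    · exact Or.inl ((le_inf (h' k) (h' l)).trans (pair_le_m hn j hkl))
    · exact Or.inr ((le_inf (h' k) (h' l)).trans (pair_le_m hn j hkl))

theorem top_of_gen (hx : IsFreelyGenerated.{_, _, w} x) {a : F} (ha : IsSymmElem a) {i : Fin n}
    (h : x i ≤ a) (y : F) : y ≤ a := by
  revert y
  apply closure_ind hx.1
  · intro k
    obtain ⟨π, hπ⟩ := perm_aut hx (Equiv.swap i k)
    have := π.monotone h
    rwa [ha, hπ, Equiv.swap_apply_left] at this
  · intro c d
    exact sup_le
  · intro c d hc _
    exact inf_le_of_left_le hc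

theorem m_le_of_pair (hn : 3 ≤ n) (hx : IsFreelyGenerated.{_, _, w} x) {a : F}
    (ha : IsSymmElem a) (j : ℕ) {p q : Fin n} (hpq : p ≠ q)
    (h : freeP x j p ⊓ freeP x j q ≤ a) : freeM hn x j ≤ a := by
  unfold freeM
  apply Finset.sup'_le
  rintro ⟨i, k⟩ hik
  simp only [Finset.mem_filter, Finset.mem_univ, true_and] at hik
  obtain ⟨σ, s1, s2⟩ : ∃ σ : Equiv.Perm (Fin n), σ i = p ∧ σ k = q := by
    refine ⟨(Equiv.swap i p).trans (Equiv.swap (Equiv.swap i p k) q), ?_, ?_⟩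
    · rw [Equiv.trans_apply, Equiv.swap_apply_left, Equiv.swap_apply_of_ne_of_ne _ hpq]
      intro h
      apply hik
      apply (Equiv.swap i p).injective
      rw [Equiv.swap_apply_left]
      exact h
    · rw [Equiv.trans_apply, Equiv.swap_apply_left]
  obtain ⟨π, hπ⟩ := perm_aut hx σ
  have h1 := perm_p π σ hπ j i
  have h2 := perm_p π σ hπ j k
  rw [s1] at h1
  rw [s2] at h2
  rw [← π.le_iff_le, ha, map_inf]
  exact (inf_le_inf h1 h2).trans h

theorem m_join (hn : 3 ≤ n) (hx : IsFreelyGenerated.{_, _, w} x) {a b : F} (ha : IsSymmElem a)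
    (hb : IsSymmElem b) (j : ℕ) (h : freeM hn x j ≤ a ⊔ b) :
    freeM hn x j ≤ a ∨ freeM hn x j ≤ b := by
  obtain ⟨k, l, hkl, -, -⟩ := exists_two hn ⟨0, by omega⟩
  have hg : ∀ i, freeP x j i ≤ a ⊔ b → freeM hn x j ≤ a ∨ freeM hn x j ≤ b := by
    intro i hi
    rcases gen_join hx ((x_le_p j i).trans hi) with h | h
    · exact Or.inl (top_of_gen hx ha h _)
    · exact Or.inr (top_of_gen hx hb h _)
  rcases whitman hx ((pair_le_m hn j hkl).trans h) with h | h | h | h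
  · exact hg _ h
  · exact hg _ h
  · exact Or.inl (m_le_of_pair hn hx ha j hkl h)
  · exact Or.inr (m_le_of_pair hn hx hb j hkl h)

theorem symm_dual (δ : F ≃o Fᵒᵈ) {a : F} (ha : IsSymmElem a) :
    IsSymmElem (δ.symm (OrderDual.toDual a)) := by
  intro π
  have h := ha (((δ.symm.trans π).trans δ).dual.trans (OrderIso.dualDual F).symm |>
    fun e => (OrderIso.dualDual F).trans e)
  have h' : δ (π (δ.symm (OrderDual.toDual a))) = OrderDual.toDual a := h
  exact (δ.symm_apply_apply _).symm.trans (congrArg δ.symm h')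

end

end FreeMAux

theorem freeM_doubly_prime {n : ℕ} (hn : 3 ≤ n)
    {F : Type*} [Lattice F] (x : Fin n → F) (hx : IsFreelyGenerated x)
    (δ : F ≃o Fᵒᵈ) (hδ : ∀ i, dBar δ (x i) = x i) :
    ∀ j : ℕ,
      (∀ h₁ h₂ : F, IsSymmElem h₁ → IsSymmElem h₂ →
        ((freeM hn x j ≤ h₁ ⊔ h₂ → freeM hn x j ≤ h₁ ∨ freeM hn x j ≤ h₂) ∧
          (h₁ ⊓ h₂ ≤ freeM hn x j → h₁ ≤ freeM hn x j ∨ h₂ ≤ freeM hn x j))) ∧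
      (∀ h₁ h₂ : F, IsSymmElem h₁ → IsSymmElem h₂ →
        ((dBar δ (freeM hn x j) ≤ h₁ ⊔ h₂ →
            dBar δ (freeM hn x j) ≤ h₁ ∨ dBar δ (freeM hn x j) ≤ h₂) ∧
          (h₁ ⊓ h₂ ≤ dBar δ (freeM hn x j) →
            h₁ ≤ dBar δ (freeM hn x j) ∨ h₂ ≤ dBar δ (freeM hn x j)))) := by
  intro j
  have key1 : ∀ t a : F, dBar δ t ≤ a ↔ δ.symm (OrderDual.toDual a) ≤ t := by
    intro t a
    rw [OrderIso.symm_apply_le]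
    exact Iff.rfl
  have key2 : ∀ t a : F, a ≤ dBar δ t ↔ t ≤ δ.symm (OrderDual.toDual a) := by
    intro t a
    rw [OrderIso.le_symm_apply]
    exact Iff.rfl
  refine ⟨fun a b ha hb => ⟨FreeMAux.m_join hn hx ha hb j, FreeMAux.m_meet hn hx ha hb j⟩,
    fun a b ha hb => ⟨fun h => ?_, fun h => ?_⟩⟩
  · rw [key1, toDual_sup, map_inf] at h
    rw [key1, key1]
    exact FreeMAux.m_meet hn hx (FreeMAux.symm_dual δ ha) (FreeMAux.symm_dual δ hb) j h
  · rw [key2, toDual_inf, map_sup] at h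
    rw [key2, key2]
    exact FreeMAux.m_join hn hx (FreeMAux.symm_dual δ ha) (FreeMAux.symm_dual δ hb) j h
end

section
/- Let s := ⨆ over i < n of (⨅ over i' ≠ i of x i'). Then: (i) if n > 3, then s < m 0 and ¬(m 0 ≤ (m 0)̄); (ii) if n = 3, then ¬(m 1 ≤ (m 1)̄), while m 0 = s, s < s̄, and s̄ = (m 0)̄ (where s̄ = δ s); (iii) for all i, j ∈ ℕ with i ≥ 1 and j ≥ 1, ¬(m i ≤ (m j)̄); (iv) for all i, j ∈ ℕ, ¬((m j)̄ ≤ m i). -/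
open Cardinal

universe u

namespace FreeMAux

/-- The lattice consisting of a bottom, a top and `n` atoms. -/
inductive MM (n : ℕ) : Type u
  | bot : MM n
  | top : MM n
  | atom : Fin n → MM n

/-- The order of `MM n`. -/
def MM.le {n : ℕ} : MM.{u} n → MM.{u} n → Prop
  | .bot, _ => True
  | _, .top => True
  | .atom i, .atom j => i = j
  | _, _ => False

/-- Joins in `MM n`. -/
def MM.sup {n : ℕ} : MM.{u} n → MM.{u} n → MM.{u} n
  | .bot, a => a
  | a, .bot => a
  | .atom i, .atom j => if i = j then .atom i else .top
  | _, _ => .top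

/-- Meets in `MM n`. -/
def MM.inf {n : ℕ} : MM.{u} n → MM.{u} n → MM.{u} n
  | .top, a => a
  | a, .top => a
  | .atom i, .atom j => if i = j then .atom i else .bot
  | _, _ => .bot

instance (n : ℕ) : Lattice (MM.{u} n) where
  le := MM.le
  le_refl a := by cases a <;> simp [MM.le]
  le_trans a b c := by cases a <;> cases b <;> cases c <;> simp +contextual [MM.le]
  le_antisymm a b := by cases a <;> cases b <;> simp +contextual [MM.le]
  sup := MM.sup
  inf := MM.inf
  le_sup_left a b := by cases a <;> cases b <;> simp [MM.le, MM.sup] <;> split_ifs <;> simp_all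
  le_sup_right a b := by cases a <;> cases b <;> simp [MM.le, MM.sup] <;> split_ifs <;> simp_all
  sup_le a b c := by
    cases a <;> cases b <;> cases c <;> simp [MM.le, MM.sup] <;> split_ifs <;> simp_all
    rintro rfl h
    simp_all
  inf_le_left a b := by cases a <;> cases b <;> simp [MM.le, MM.inf] <;> split_ifs <;> simp_all
  inf_le_right a b := by cases a <;> cases b <;> simp [MM.le, MM.inf] <;> split_ifs <;> simp_all
  le_inf a b c := by
    cases a <;> cases b <;> cases c <;> simp [MM.le, MM.inf] <;> split_ifs <;> simp_all

theorem MM.bot_le {n : ℕ} (a : MM.{u} n) : MM.bot ≤ a := by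
  cases a <;> exact trivial

theorem MM.le_top {n : ℕ} (a : MM.{u} n) : a ≤ MM.top := by
  cases a <;> exact trivial

theorem MM.not_top_le {n : ℕ} : ¬ (MM.top : MM.{u} n) ≤ MM.bot := fun h => h

/-- The pentagon, with `a < c`. -/
inductive N5 : Type u
  | bot | a | c | b | top

/-- The order of the pentagon. -/
def N5.le : N5.{u} → N5.{u} → Bool
  | .bot, _ => true
  | _, .top => true
  | .a, .a => true
  | .a, .c => true
  | .c, .c => true
  | .b, .b => true
  | _, _ => false

/-- Joins in the pentagon. -/
def N5.sup (s t : N5.{u}) : N5.{u} :=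
  if s.le t then t else if t.le s then s else .top

/-- Meets in the pentagon. -/
def N5.inf (s t : N5.{u}) : N5.{u} :=
  if s.le t then s else if t.le s then t else .bot

instance : Lattice N5.{u} where
  le s t := N5.le s t = true
  le_refl s := by cases s <;> rfl
  le_trans s t r := by cases s <;> cases t <;> cases r <;> simp [N5.le]
  le_antisymm s t := by cases s <;> cases t <;> simp [N5.le]
  sup := N5.sup
  inf := N5.inf
  le_sup_left s t := by cases s <;> cases t <;> rfl
  le_sup_right s t := by cases s <;> cases t <;> rfl
  sup_le s t r := by cases s <;> cases t <;> cases r <;> simp [N5.le, N5.sup]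
  inf_le_left s t := by cases s <;> cases t <;> rfl
  inf_le_right s t := by cases s <;> cases t <;> rfl
  le_inf s t r := by cases s <;> cases t <;> cases r <;> simp [N5.le, N5.inf]

section general

variable {n : ℕ} {L : Type*} [Lattice L]

theorem fold_le_iff {α : Type*} (s : Finset α) (b c : L) (f : α → L) :
    Finset.fold (β := L) (· ⊔ ·) b f s ≤ c ↔ b ≤ c ∧ ∀ q ∈ s, f q ≤ c := by
  classical
  induction s using Finset.induction_on with
  | empty => simp
  | insert a s ha ih =>
    rw [Finset.fold_insert ha, sup_le_iff, ih]
    simp only [Finset.forall_mem_insert]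
    tauto

theorem pairs_nonempty (hn : 3 ≤ n) :
    (Finset.univ.filter fun q : Fin n × Fin n => q.1 ≠ q.2).Nonempty :=
  ⟨(⟨0, by omega⟩, ⟨1, by omega⟩), by simp [Fin.ext_iff]⟩

theorem freeM_eq (hn : 3 ≤ n) (y : Fin n → L) (j : ℕ) :
    freeM hn y j = (Finset.univ.filter fun q : Fin n × Fin n => q.1 ≠ q.2).sup'
      (pairs_nonempty hn) (fun q => freeP y j q.1 ⊓ freeP y j q.2) := rfl

theorem univ_nonempty (hn : 3 ≤ n) : (Finset.univ : Finset (Fin n)).Nonempty :=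
  ⟨⟨0, by omega⟩, Finset.mem_univ _⟩

theorem erase_nonempty (hn : 3 ≤ n) (i : Fin n) :
    ((Finset.univ : Finset (Fin n)).erase i).Nonempty := by
  apply Finset.card_pos.mp
  rw [Finset.card_erase_of_mem (Finset.mem_univ _), Finset.card_univ, Fintype.card_fin]
  omega

theorem sElem_eq (hn : 3 ≤ n) (y : Fin n → L) :
    sElem hn y = Finset.univ.sup' (univ_nonempty hn) fun i =>
      (Finset.univ.erase i).inf' (erase_nonempty hn i) y := rfl

theorem freeP_succ_le_iff (y : Fin n → L) (j : ℕ) (i : Fin n) (c : L) :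
    freeP y (j + 1) i ≤ c ↔ y i ≤ c ∧
      ∀ k l : Fin n, k ≠ l → k ≠ i → l ≠ i → freeP y j k ⊓ freeP y j l ≤ c := by
  rw [freeP, fold_le_iff]
  simp only [Finset.mem_filter, Finset.mem_univ, true_and, Prod.forall, and_imp]

theorem freeM_le_iff (hn : 3 ≤ n) (y : Fin n → L) (j : ℕ) (c : L) :
    freeM hn y j ≤ c ↔ ∀ k l : Fin n, k ≠ l → freeP y j k ⊓ freeP y j l ≤ c := by
  rw [freeM_eq, Finset.sup'_le_iff]
  simp only [Finset.mem_filter, Finset.mem_univ, true_and, Prod.forall]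

theorem freeP_le_succ (y : Fin n → L) (j : ℕ) (i : Fin n) :
    freeP y j i ≤ freeP y (j + 1) i := by
  induction j generalizing i with
  | zero => exact ((freeP_succ_le_iff y 0 i _).1 le_rfl).1
  | succ j ih =>
    rw [freeP_succ_le_iff]
    have h := (freeP_succ_le_iff y (j + 1) i _).1 le_rfl
    exact ⟨h.1, fun k l h1 h2 h3 => (inf_le_inf (ih k) (ih l)).trans (h.2 k l h1 h2 h3)⟩

theorem freeM_mono (hn : 3 ≤ n) (y : Fin n → L) : Monotone (freeM hn y) := by
  refine monotone_nat_of_le_succ fun j => ?_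
  rw [freeM_le_iff]
  intro k l hkl
  exact (inf_le_inf (freeP_le_succ y j k) (freeP_le_succ y j l)).trans
    ((freeM_le_iff hn y (j + 1) _).1 le_rfl k l hkl)

theorem map_freeP {K : Type*} [Lattice K] (φ : LatticeHom L K) (y : Fin n → L) (j : ℕ)
    (i : Fin n) : φ (freeP y j i) = freeP (fun i => φ (y i)) j i := by
  induction j generalizing i with
  | zero => rfl
  | succ j ih =>
    rw [freeP, freeP, ← Finset.fold_hom (op := (· ⊔ ·)) (m := φ) (fun a b => map_sup φ a b)]
    simp only [map_inf, ih]

theorem map_freeM {K : Type*} [Lattice K] (hn : 3 ≤ n) (φ : LatticeHom L K) (y : Fin n → L)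
    (j : ℕ) : φ (freeM hn y j) = freeM hn (fun i => φ (y i)) j := by
  rw [freeM_eq, freeM_eq, map_finset_sup']
  congr 1
  funext q
  simp [map_inf, map_freeP]

/-- The dual polynomial. -/
def dualM (hn : 3 ≤ n) (y : Fin n → L) (j : ℕ) : L :=
  OrderDual.ofDual (freeM (F := Lᵒᵈ) hn (fun i => OrderDual.toDual (y i)) j)

theorem dBar_freeM (hn : 3 ≤ n) (x : Fin n → L) (δ : L ≃o Lᵒᵈ) (hδ : ∀ i, dBar δ (x i) = x i)
    (j : ℕ) : dBar δ (freeM hn x j) = dualM hn x j := by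
  have h := map_freeM hn
    ({ toFun := δ, map_sup' := map_sup δ, map_inf' := map_inf δ } : LatticeHom L Lᵒᵈ) x j
  have h' : δ (freeM hn x j) = freeM hn (fun i => δ (x i)) j := h
  have hx : (fun i => δ (x i)) = fun i => OrderDual.toDual (x i) := funext fun i => hδ i
  rw [dBar, h', hx, dualM]

theorem map_dualM {K : Type*} [Lattice K] (hn : 3 ≤ n) (φ : LatticeHom L K) (y : Fin n → L)
    (j : ℕ) : φ (dualM hn y j) = dualM hn (fun i => φ (y i)) j :=
  map_freeM hn (LatticeHom.dual φ) (fun i => OrderDual.toDual (y i)) j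

theorem le_dualM_iff (hn : 3 ≤ n) (y : Fin n → L) (c : L) :
    c ≤ dualM hn y 0 ↔ ∀ k l : Fin n, k ≠ l → c ≤ y k ⊔ y l :=
  freeM_le_iff (L := Lᵒᵈ) hn _ 0 (OrderDual.toDual c)

theorem freeP_of_disjoint (y : Fin n → L) (b : L) (hb : ∀ i, b ≤ y i)
    (h : ∀ i k, i ≠ k → y i ⊓ y k ≤ b) (j : ℕ) (i : Fin n) : freeP y j i ≤ y i := by
  induction j generalizing i with
  | zero => exact le_rfl
  | succ j ih =>
    rw [freeP_succ_le_iff]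
    exact ⟨le_rfl, fun k l hkl _ _ => (inf_le_inf (ih k) (ih l)).trans ((h k l hkl).trans (hb i))⟩

theorem freeM_of_disjoint (hn : 3 ≤ n) (y : Fin n → L) (b : L) (hb : ∀ i, b ≤ y i)
    (h : ∀ i k, i ≠ k → y i ⊓ y k ≤ b) (j : ℕ) : freeM hn y j ≤ b := by
  rw [freeM_le_iff]
  exact fun k l hkl => (inf_le_inf (freeP_of_disjoint y b hb h j k)
    (freeP_of_disjoint y b hb h j l)).trans (h k l hkl)

theorem exists_pair (hn : 3 ≤ n) (i : Fin n) : ∃ a b : Fin n, a ≠ b ∧ a ≠ i ∧ b ≠ i := by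
  have h : 1 < (Finset.univ.erase i).card := by
    rw [Finset.card_erase_of_mem (Finset.mem_univ _), Finset.card_univ, Fintype.card_fin]
    omega
  obtain ⟨a, ha, b, hb, hab⟩ := Finset.one_lt_card.1 h
  exact ⟨a, b, hab, Finset.ne_of_mem_erase ha, Finset.ne_of_mem_erase hb⟩

theorem sElem_le (hn : 3 ≤ n) (x : Fin n → L) : sElem hn x ≤ freeM hn x 0 := by
  rw [sElem_eq, Finset.sup'_le_iff]
  intro i _
  obtain ⟨a, b, hab, ha, hb⟩ := exists_pair hn i
  refine le_trans (le_inf ?_ ?_) ((freeM_le_iff hn x 0 _).1 le_rfl a b hab)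
  · exact Finset.inf'_le _ (Finset.mem_erase.2 ⟨ha, Finset.mem_univ _⟩)
  · exact Finset.inf'_le _ (Finset.mem_erase.2 ⟨hb, Finset.mem_univ _⟩)

theorem freeM_zero_three (hn : 3 ≤ 3) (x : Fin 3 → L) : freeM hn x 0 = sElem hn x := by
  refine le_antisymm ?_ (sElem_le hn x)
  rw [freeM_le_iff]
  intro k l hkl
  obtain ⟨r, hr⟩ : ∃ r : Fin 3, ∀ t, t ≠ r → t = k ∨ t = l := by
    revert k l; decide
  refine le_trans ?_ (Finset.le_sup' _ (Finset.mem_univ r))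
  refine Finset.le_inf' _ _ fun t ht => ?_
  rcases hr t (Finset.ne_of_mem_erase ht) with rfl | rfl
  · exact inf_le_left
  · exact inf_le_right

theorem freeM_le_dualM_three (hn : 3 ≤ 3) (x : Fin 3 → L) : freeM hn x 0 ≤ dualM hn x 0 := by
  rw [freeM_le_iff]
  intro k l hkl
  rw [le_dualM_iff]
  intro r t hrt
  have : r = k ∨ r = l ∨ t = k ∨ t = l := by
    revert k l r t; decide
  rcases this with rfl | rfl | rfl | rfl
  · exact inf_le_left.trans le_sup_left
  · exact inf_le_right.trans le_sup_left
  · exact inf_le_left.trans le_sup_right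
  · exact inf_le_right.trans le_sup_right

theorem MM_dualM (hn : 3 ≤ n) (i j : ℕ) :
    ¬ dualM hn (MM.atom : Fin n → MM.{u} n) j ≤ freeM hn MM.atom i := by
  intro h
  have h1 : freeM hn (MM.atom : Fin n → MM.{u} n) i ≤ MM.bot := by
    refine freeM_of_disjoint hn _ _ (fun i => MM.bot_le _) (fun i k hik => ?_) i
    change MM.le (MM.inf _ _) _
    simp [MM.inf, MM.le, hik]
  have h2 : MM.top ≤ dualM hn (MM.atom : Fin n → MM.{u} n) j := by
    refine freeM_of_disjoint (L := (MM.{u} n)ᵒᵈ) hn _ (OrderDual.toDual MM.top)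
      (fun i => MM.le_top _) (fun i k hik => ?_) j
    change MM.le MM.top (MM.sup (MM.atom i) (MM.atom k))
    simp [MM.sup, MM.le, hik]
  exact MM.not_top_le (h2.trans (h.trans h1))

/-- The two-valued test assignment. -/
def two (n : ℕ) (i : Fin n) : MM.{u} n := if i.1 < 2 then MM.top else MM.bot

theorem top_le_freeM_two (hn : 3 ≤ n) : MM.top ≤ freeM hn (two.{u} n) 0 := by
  have h := (freeM_le_iff hn (two.{u} n) 0 _).1 le_rfl ⟨0, by omega⟩ ⟨1, by omega⟩ (by simp)
  refine le_trans (le_inf ?_ ?_) h <;> simp [freeP, two]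

theorem dualM_two_le (hn : 3 ≤ n) (h3 : 3 < n) : dualM hn (two.{u} n) 0 ≤ MM.bot := by
  have h := (le_dualM_iff hn (two.{u} n) _).1 le_rfl ⟨2, by omega⟩ ⟨3, by omega⟩ (by simp)
  refine h.trans (sup_le ?_ ?_) <;> simp [two]

theorem sElem_two_le (hn : 3 ≤ n) (h3 : 3 < n) : sElem hn (two.{u} n) ≤ MM.bot := by
  rw [sElem_eq, Finset.sup'_le_iff]
  intro i _
  by_cases hi : i.1 = 2
  · refine (Finset.inf'_le (b := (⟨3, by omega⟩ : Fin n)) _ ?_).trans ?_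
    · simp [Fin.ext_iff]; omega
    · simp [two]
  · refine (Finset.inf'_le (b := (⟨2, by omega⟩ : Fin n)) _ ?_).trans ?_
    · simp [Fin.ext_iff]; omega
    · simp [two]

theorem map_sElem {K : Type*} [Lattice K] (hn : 3 ≤ n) (φ : LatticeHom L K) (y : Fin n → L) :
    φ (sElem hn y) = sElem hn (fun i => φ (y i)) := by
  rw [sElem_eq, sElem_eq, map_finset_sup']
  congr 1
  funext q
  simp only [Function.comp_apply]
  rw [map_finset_inf']
  rfl

/-- The pentagon test assignment. -/
def five : Fin 3 → N5.{u} := ![N5.a, N5.b, N5.c]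

theorem N5_freeM (hn : 3 ≤ 3) : ¬ freeM hn five.{u} 1 ≤ dualM hn five.{u} 1 := by
  intro h
  have hp : ∀ i k l : Fin 3, k ≠ l → k ≠ i → l ≠ i →
      five.{u} i ⊔ (five k ⊓ five l) ≤ freeP five 1 i := fun i k l h1 h2 h3 =>
    sup_le ((freeP_succ_le_iff _ 0 i _).1 le_rfl).1
      (((freeP_succ_le_iff _ 0 i _).1 le_rfl).2 k l h1 h2 h3)
  have hq : ∀ i k l : Fin 3, k ≠ l → k ≠ i → l ≠ i →
      OrderDual.ofDual (freeP (F := (N5.{u})ᵒᵈ) (fun i => OrderDual.toDual (five i)) 1 i) ≤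
        five.{u} i ⊓ (five k ⊔ five l) := fun i k l h1 h2 h3 =>
    le_inf ((freeP_succ_le_iff (L := (N5.{u})ᵒᵈ) (fun i => OrderDual.toDual (five i)) 0 i _).1 le_rfl).1
      (((freeP_succ_le_iff (L := (N5.{u})ᵒᵈ) (fun i => OrderDual.toDual (five i)) 0 i _).1 le_rfl).2 k l h1 h2 h3)
  have h1 : N5.c ≤ freeM hn five.{u} 1 :=
    le_trans (le_trans (show N5.c ≤ _ from rfl)
      (inf_le_inf (hp 1 0 2 (by decide) (by decide) (by decide))
        (hp 2 0 1 (by decide) (by decide) (by decide))))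
      ((freeM_le_iff hn five.{u} 1 _).1 le_rfl 1 2 (by decide))
  have h2 : dualM hn five.{u} 1 ≤ N5.a :=
    le_trans ((freeM_le_iff (L := (N5.{u})ᵒᵈ) hn _ 1 _).1 le_rfl 0 1 (by decide))
      (le_trans (sup_le_sup (hq 0 1 2 (by decide) (by decide) (by decide))
        (hq 1 0 2 (by decide) (by decide) (by decide))) (show _ ≤ N5.a from rfl))
  have h3 : (N5.c : N5.{u}) ≤ N5.a := h1.trans (h.trans h2)
  exact absurd (show N5.le N5.c N5.a = true from h3) (by simp [N5.le])

end general

end FreeMAux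

open FreeMAux

theorem freeM_order_relations {n : ℕ} (hn : 3 ≤ n)
    {F : Type*} [Lattice F] (x : Fin n → F) (hx : IsFreelyGenerated x)
    (δ : F ≃o Fᵒᵈ) (hδ : ∀ i, dBar δ (x i) = x i) :
    (3 < n → sElem hn x < freeM hn x 0 ∧ ¬ freeM hn x 0 ≤ dBar δ (freeM hn x 0)) ∧
    (n = 3 → ¬ freeM hn x 1 ≤ dBar δ (freeM hn x 1) ∧ freeM hn x 0 = sElem hn x ∧
      sElem hn x < dBar δ (sElem hn x) ∧ dBar δ (sElem hn x) = dBar δ (freeM hn x 0)) ∧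
    (∀ i j : ℕ, 1 ≤ i → 1 ≤ j → ¬ freeM hn x i ≤ dBar δ (freeM hn x j)) ∧
    (∀ i j : ℕ, ¬ dBar δ (freeM hn x j) ≤ freeM hn x i) := by
  have hd := dBar_freeM hn x δ hδ
  have hanti : Antitone (dualM hn x) := fun i j hij =>
    freeM_mono (L := Fᵒᵈ) hn (fun i => OrderDual.toDual (x i)) hij
  have h4 : ∀ i j : ℕ, ¬ dualM hn x j ≤ freeM hn x i := by
    intro i j h
    obtain ⟨φ, hφ⟩ := hx.2 (MM n) MM.atom
    have h' := OrderHomClass.mono φ h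
    rw [map_freeM, map_dualM] at h'
    simp only [hφ] at h'
    exact MM_dualM hn i j h'
  have h1 : 3 < n → ¬ freeM hn x 0 ≤ sElem hn x ∧ ¬ freeM hn x 0 ≤ dualM hn x 0 := by
    intro h3
    obtain ⟨φ, hφ⟩ := hx.2 (MM n) (two n)
    constructor
    · intro h
      have h' := OrderHomClass.mono φ h
      rw [map_freeM, map_sElem] at h'
      simp only [hφ] at h'
      exact MM.not_top_le ((top_le_freeM_two hn).trans (h'.trans (sElem_two_le hn h3)))
    · intro h
      have h' := OrderHomClass.mono φ h
      rw [map_freeM, map_dualM] at h'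
      simp only [hφ] at h'
      exact MM.not_top_le ((top_le_freeM_two hn).trans (h'.trans (dualM_two_le hn h3)))
  have h2 : ¬ freeM hn x 1 ≤ dualM hn x 1 := by
    rcases hn.lt_or_eq with h3 | rfl
    · exact fun h => (h1 h3).2 (((freeM_mono hn x zero_le_one).trans h).trans (hanti zero_le_one))
    · intro h
      obtain ⟨φ, hφ⟩ := hx.2 N5 five
      have h' := OrderHomClass.mono φ h
      rw [map_freeM, map_dualM] at h'
      simp only [hφ] at h'
      exact N5_freeM hn h'
  simp only [hd]
  refine ⟨fun h3 => ⟨lt_of_le_not_ge (sElem_le hn x) (h1 h3).1, (h1 h3).2⟩, ?_, ?_, h4⟩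
  · rintro rfl
    have hs := freeM_zero_three hn x
    refine ⟨h2, hs, ?_, ?_⟩
    · rw [← hs, hd]
      exact lt_of_le_not_ge (freeM_le_dualM_three hn x) (h4 0 0)
    · rw [← hs, hd]
  · exact fun i j hi hj h => h2 (((freeM_mono hn x hi).trans h).trans (hanti hj))
end
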